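/- arXiv:1110.6012 — 4 statements merged into one kernel-verified Lean document; each statement's English description precedes it below -/
import Mathlib

section
/- Let C ⊆ F2^72 be a binary self-dual doubly-even linear code with minimum nonzero weight 16, and let g ∈ S_72 be the permutation that is the product of the 24 disjoint 3-cycles (3k+1, 3k+2, 3k+3) for k = 0,…,23. Assume g ∈ Aut(C). Define G := {a ∈ F2^24 : r3(a) ∈ C}, where r3(a) ∈ F2^72 is the vector whose entry at position 3k+j (k = 0,…,23, j = 1,2,3) equals a_{k+1}. Then G is a self-dual doubly-even binary code of dimension 12 with minimum nonzero weight 8 (i.e., G has the parameters of the extended binary Golay code), and the fixed code {c ∈ C : c∘g = c} equals {r3(a) : a ∈ G}. -/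
/-- The Hamming weight of a binary vector: the number of nonzero coordinates. -/
def wt {n : ℕ} (c : Fin n → ZMod 2) : ℕ := (Finset.univ.filter fun i => c i ≠ 0).card

/-- The standard inner product on `F2^n`. -/
def inner2 {n : ℕ} (v w : Fin n → ZMod 2) : ZMod 2 := ∑ i, v i * w i

/-- A binary code is self-dual if it equals its dual with respect to the
standard inner product. -/
def IsSelfDual {n : ℕ} (C : Submodule (ZMod 2) (Fin n → ZMod 2)) : Prop :=
  (C : Set (Fin n → ZMod 2)) = {v | ∀ c ∈ C, inner2 v c = 0}

/-- A binary code is doubly even if every codeword has weight divisible by 4. -/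
def IsDoublyEven {n : ℕ} (C : Submodule (ZMod 2) (Fin n → ZMod 2)) : Prop :=
  ∀ c ∈ C, 4 ∣ wt c

/-- The permutation of `{1,…,72}` that is the product of the 24 disjoint
3-cycles `(3k+1, 3k+2, 3k+3)`, written 0-indexed on `Fin 72`. -/
def g3 : Equiv.Perm (Fin 72) where
  toFun i := ⟨3 * (i.val / 3) + ((i.val % 3 + 1) % 3), by have := i.isLt; omega⟩
  invFun i := ⟨3 * (i.val / 3) + ((i.val % 3 + 2) % 3), by have := i.isLt; omega⟩
  left_inv := by decide
  right_inv := by decide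

/-- The 3-fold repetition map `F2^24 → F2^72`: the entry of `r3 a` at position
`3k+j` (`j = 1,2,3`) equals `a_{k+1}`. -/
def r3 : (Fin 24 → ZMod 2) →ₗ[ZMod 2] (Fin 72 → ZMod 2) where
  toFun a := fun i => a ⟨i.val / 3, by have := i.isLt; omega⟩
  map_add' := fun _ _ => rfl
  map_smul' := fun _ _ => rfl

theorem sum72 {M : Type*} [AddCommMonoid M] (f : Fin 72 → M) :
    ∑ i, f i = ∑ k : Fin 24, (f ⟨3 * k.val, by omega⟩ + f ⟨3 * k.val + 1, by omega⟩
      + f ⟨3 * k.val + 2, by omega⟩) := by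
  rw [← (finProdFinEquiv : Fin 24 × Fin 3 ≃ Fin (24 * 3)).sum_comp f, Fintype.sum_prod_type]
  refine Finset.sum_congr rfl fun k _ => ?_
  rw [Fin.sum_univ_three]
  congr 2
  · congr 1; ext; simp [finProdFinEquiv]
  · congr 1; ext; simp [finProdFinEquiv]; omega
  · ext; simp [finProdFinEquiv]; omega

theorem wt_eq_sum {n : ℕ} (c : Fin n → ZMod 2) : wt c = ∑ i, if c i ≠ 0 then 1 else 0 := by
  rw [wt, Finset.card_filter]

theorem r3_apply (a : Fin 24 → ZMod 2) (i : Fin 72) :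
    r3 a i = a ⟨i.val / 3, by have := i.isLt; omega⟩ := rfl

theorem r3_0 (a : Fin 24 → ZMod 2) (k : Fin 24) : r3 a ⟨3 * k.val, by omega⟩ = a k := by
  rw [r3_apply]; congr 1; ext; simp

theorem r3_1 (a : Fin 24 → ZMod 2) (k : Fin 24) : r3 a ⟨3 * k.val + 1, by omega⟩ = a k := by
  rw [r3_apply]; congr 1; ext; simp; omega

theorem r3_2 (a : Fin 24 → ZMod 2) (k : Fin 24) : r3 a ⟨3 * k.val + 2, by omega⟩ = a k := by
  rw [r3_apply]; congr 1; ext; simp; omega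

theorem wt_r3 (a : Fin 24 → ZMod 2) : wt (r3 a) = 3 * wt a := by
  rw [wt_eq_sum, wt_eq_sum, sum72, Finset.mul_sum]
  refine Finset.sum_congr rfl fun k _ => ?_
  rw [r3_0, r3_1, r3_2]; ring

/-- Coordinate sums over the 3-cycles. -/
def tr3 (c : Fin 72 → ZMod 2) : Fin 24 → ZMod 2 := fun k =>
  c ⟨3 * k.val, by omega⟩ + c ⟨3 * k.val + 1, by omega⟩ + c ⟨3 * k.val + 2, by omega⟩

theorem inner_r3 (v : Fin 24 → ZMod 2) (c : Fin 72 → ZMod 2) :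
    inner2 (r3 v) c = inner2 v (tr3 c) := by
  rw [inner2, inner2, sum72]
  refine Finset.sum_congr rfl fun k _ => ?_
  rw [r3_0, r3_1, r3_2, tr3]; ring

theorem tr3_r3 (a : Fin 24 → ZMod 2) : tr3 (r3 a) = a := by
  funext k
  rw [tr3, r3_0, r3_1, r3_2]
  generalize a k = x
  revert x; decide

theorem r3_tr3 (c : Fin 72 → ZMod 2) : r3 (tr3 c) = c + c ∘ g3 + (c ∘ g3) ∘ g3 := by
  funext i
  obtain ⟨i, hi⟩ := i
  have h : i % 3 = 0 ∨ i % 3 = 1 ∨ i % 3 = 2 := by omega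
  simp only [r3_apply, tr3, Pi.add_apply, Function.comp_apply, g3, Equiv.coe_fn_mk]
  rcases h with h | h | h
  · have e0 : 3 * (i / 3) = i := by omega
    have e1 : (i + 1) % 3 = 1 := by omega
    have e2 : (i + 1) / 3 = i / 3 := by omega
    simp [h, e0, e1, e2]
  · have e0 : 3 * (i / 3) + 1 = i := by omega
    have e1 : 3 * (i / 3) + 2 = i + 1 := by omega
    have e2 : (3 * (i / 3) + 2) / 3 = i / 3 := by omega
    have e3 : (3 * (i / 3) + 2) % 3 = 2 := by omega
    simp [h, e0, e2, e3]; ring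
  · have e0 : 3 * (i / 3) + 2 = i := by omega
    simp [h, e0]; ring

theorem golay_finrank (G : Submodule (ZMod 2) (Fin 24 → ZMod 2)) (h : IsSelfDual G) :
    Module.finrank (ZMod 2) G = 12 := by
  have e : (G.map (dotProductEquiv (ZMod 2) (Fin 24)).toLinearMap).dualCoannihilator = G := by
    ext v
    rw [Submodule.mem_dualCoannihilator, ← SetLike.mem_coe (p := G), h]
    have hd : ∀ c, dotProductEquiv (ZMod 2) (Fin 24) c v = inner2 v c := fun c => by
      simp [inner2, dotProduct, mul_comm]
    constructor
    · intro H c hc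
      rw [← hd]
      exact H _ ⟨c, hc, rfl⟩
    · rintro H _ ⟨c, hc, rfl⟩
      exact (hd c).trans (H c hc)
  have := Subspace.finrank_add_finrank_dualCoannihilator_eq
    (G.map (dotProductEquiv (ZMod 2) (Fin 24)).toLinearMap)
  rw [e, LinearEquiv.finrank_map_eq] at this
  simp at this
  omega

theorem exists_vanish (G : Submodule (ZMod 2) (Fin 24 → ZMod 2))
    (h : Module.finrank (ZMod 2) G = 12) (f : Fin 11 → Fin 24) :
    ∃ a ∈ G, a ≠ 0 ∧ ∀ i, a (f i) = 0 := by
  have hk := LinearMap.ker_ne_bot_of_finrank_lt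
    (f := (LinearMap.funLeft (ZMod 2) (ZMod 2) f).comp G.subtype) (by simp [h])
  obtain ⟨x, hx, h0⟩ := Submodule.exists_mem_ne_zero_of_ne_bot hk
  refine ⟨x, x.2, by simpa using h0, fun i => ?_⟩
  exact congrFun (LinearMap.mem_ker.1 hx) i

theorem exists_wt_lt (G : Submodule (ZMod 2) (Fin 24 → ZMod 2))
    (h : Module.finrank (ZMod 2) G = 12) : ∃ a ∈ G, a ≠ 0 ∧ wt a < 12 := by
  by_contra! H
  obtain ⟨a, ha, ha0, hav⟩ := exists_vanish G h (fun i => ⟨i.val, by omega⟩)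
  obtain ⟨j, hj⟩ := Function.ne_iff.1 ha0
  obtain ⟨b, hb, hb0, hbv⟩ := exists_vanish G h
    (fun i => if h : i.val < 10 then ⟨i.val, by omega⟩ else j)
  have hbj : b j = 0 := by simpa using hbv 10
  have hab : a + b ≠ 0 := fun h => hj (by simpa [hbj] using congrFun h j)
  have h1 := H a ha ha0
  have h2 := H b hb hb0
  have h3 := H _ (G.add_mem ha hb) hab
  have av : ∀ i : Fin 24, i.val < 10 → a i = 0 := fun i hi => hav ⟨i.val, by omega⟩
  have bv : ∀ i : Fin 24, i.val < 10 → b i = 0 := fun i hi => by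
    simpa [hi] using hbv ⟨i.val, by omega⟩
  have key : wt a + wt b + wt (a + b) ≤ ∑ i : Fin 24, if i.val < 10 then 0 else 2 := by
    rw [wt_eq_sum, wt_eq_sum, wt_eq_sum, ← Finset.sum_add_distrib, ← Finset.sum_add_distrib]
    refine Finset.sum_le_sum fun i _ => ?_
    split_ifs with hi <;> simp_all
    all_goals
      generalize a i = x at *
      generalize b i = y at *
      revert x y; decide
  have : (∑ i : Fin 24, if i.val < 10 then 0 else 2) = 28 := by decide
  omega

/-- For an extremal self-dual doubly-even `[72,36,16]` code invariant under the
fixed-point free permutation `g3` of order 3, the code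
`G = {a ∈ F2^24 : r3 a ∈ C}` is a self-dual doubly-even `[24,12,8]` code (the
parameters of the extended binary Golay code), and the fixed code of `g3` in
`C` equals `r3(G)`. -/
theorem fixed_code_of_order_three_is_golay (C : Submodule (ZMod 2) (Fin 72 → ZMod 2))
    (hsd : IsSelfDual C)
    (hde : IsDoublyEven C)
    (hmin : ∀ c ∈ C, c ≠ 0 → 16 ≤ wt c)
    (hex : ∃ c ∈ C, wt c = 16)
    (hg : (fun c => c ∘ ⇑g3) '' (C : Set (Fin 72 → ZMod 2)) = C) :
    IsSelfDual (C.comap r3) ∧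
    IsDoublyEven (C.comap r3) ∧
    Module.finrank (ZMod 2) (C.comap r3) = 12 ∧
    (∀ a ∈ C.comap r3, a ≠ 0 → 8 ≤ wt a) ∧
    (∃ a ∈ C.comap r3, wt a = 8) ∧
    {c : Fin 72 → ZMod 2 | c ∈ C ∧ c ∘ ⇑g3 = c}
      = ⇑r3 '' (C.comap r3 : Set (Fin 24 → ZMod 2)) := by

  have hgC : ∀ c ∈ C, c ∘ ⇑g3 ∈ C := fun c hc => by
    have : (fun c => c ∘ ⇑g3) c ∈ (C : Set (Fin 72 → ZMod 2)) := hg ▸ ⟨c, hc, rfl⟩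
    exact this
  have hmem : ∀ v, v ∈ C ↔ ∀ c ∈ C, inner2 v c = 0 := fun v => by
    rw [← SetLike.mem_coe, hsd]; rfl
  have htr : ∀ c ∈ C, tr3 c ∈ C.comap r3 := fun c hc => by
    rw [Submodule.mem_comap, r3_tr3]
    exact C.add_mem (C.add_mem hc (hgC c hc)) (hgC _ (hgC c hc))
  have hS : IsSelfDual (C.comap r3) := by
    ext v
    rw [SetLike.mem_coe, Submodule.mem_comap, hmem, Set.mem_ofPred_eq]
    constructor
    · intro h a ha
      have := h _ ha
      rwa [inner_r3, tr3_r3] at this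
    · intro h c hc
      rw [inner_r3]
      exact h _ (htr c hc)
  have hD : IsDoublyEven (C.comap r3) := fun a ha => by
    have := hde _ ha
    rw [wt_r3] at this
    omega
  have hR := golay_finrank _ hS
  have hM : ∀ a ∈ C.comap r3, a ≠ 0 → 8 ≤ wt a := fun a ha h0 => by
    have h1 := hD a ha
    have h2 := hmin (r3 a) ha fun h => h0 (by rw [← tr3_r3 a, h]; rfl)
    rw [wt_r3] at h2
    omega
  refine ⟨hS, hD, hR, hM, ?_, ?_⟩
  · obtain ⟨a, ha, h0, hl⟩ := exists_wt_lt _ hR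
    have := hM a ha h0
    have := hD a ha
    exact ⟨a, ha, by omega⟩
  · ext c
    constructor
    · rintro ⟨hc, hf⟩
      refine ⟨tr3 c, htr c hc, ?_⟩
      rw [r3_tr3, hf, hf]
      funext i
      simp only [Pi.add_apply]
      generalize c i = x
      revert x; decide
    · rintro ⟨a, ha, rfl⟩
      refine ⟨ha, ?_⟩
      funext i
      simp only [Function.comp_apply, r3_apply]
      congr 1
      ext
      simp only [g3, Equiv.coe_fn_mk]
      omega
end

section
/- Any two self-dual binary codes of length 14 with minimum nonzero weight 4 are permutation equivalent: if A, B ⊆ F2^14 are self-dual linear codes each of whose nonzero codewords has weight ≥ 4 and each containing a word of weight 4, then there exists π ∈ S_14 with {a∘π : a ∈ A} = B. -/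
/-- number of ones among the lowest 14 bits -/
def pcnt (n : ℕ) : ℕ :=
  (n >>> 0) % 2 + (n >>> 1) % 2 + (n >>> 2) % 2 + (n >>> 3) % 2 +
  (n >>> 4) % 2 + (n >>> 5) % 2 + (n >>> 6) % 2 + (n >>> 7) % 2 +
  (n >>> 8) % 2 + (n >>> 9) % 2 + (n >>> 10) % 2 + (n >>> 11) % 2 +
  (n >>> 12) % 2 + (n >>> 13) % 2

/-- orthogonality of two bit masks -/
def orth (x y : ℕ) : Bool := Nat.beq (pcnt (x &&& y) % 2) 0

/-- The candidate rows: 7-bit masks of odd weight at least 3. -/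
def cands : List ℕ := (List.range 128).filter fun m => Nat.beq (pcnt m % 2) 1 && Nat.ble 3 (pcnt m)

/-- The rows of the generator matrix `[I | M]` as 14-bit masks. -/
def gensFrom : ℕ → List ℕ → List ℕ
  | _, [] => []
  | p, m :: l => (128 * m + p) :: gensFrom (2 * p) l

/-- Generators of the standard code (two simplex codes of length 7, and the all-one word). -/
def stdWords : List ℕ := [85, 102, 120, 10880, 13056, 15360, 16383]

/-- The inner product of `s ∘ p` with `g`. -/
def dotp (s g : ℕ) : ℕ → List ℕ → Bool
  | _, [] => false
  | q, x :: p => xor (s.testBit x && g.testBit q) (dotp s g (q + 1) p)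

/-- `p` is a permutation carrying the standard code into the code generated by `G`. -/
def goodPerm (G p : List ℕ) : Bool :=
  Nat.beq p.length 14 && p.all (fun x => Nat.ble x 13) && decide p.Nodup &&
  stdWords.all fun s => G.all fun g => !dotp s g 0 p

def listEq : List ℕ → List ℕ → Bool
  | [], [] => true
  | x :: l, y :: l' => Nat.beq x y && listEq l l'
  | _, _ => false

/-- The 140 orthonormal bases of `F2^7` (as sorted lists) without vectors of weight 1, each with
a permutation carrying the standard code to the code it generates. -/
def sols : List (List ℕ × List ℕ) := [
  ([7, 11, 13, 62, 94, 110, 112], [0, 1, 3, 9, 7, 8, 10, 6, 2, 4, 5, 12, 11, 13]),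
  ([7, 11, 14, 61, 93, 109, 112], [0, 1, 3, 9, 7, 8, 10, 2, 6, 4, 5, 12, 11, 13]),
  ([7, 13, 14, 59, 91, 107, 112], [0, 1, 3, 9, 7, 8, 10, 2, 4, 6, 5, 12, 11, 13]),
  ([7, 19, 21, 62, 94, 104, 118], [0, 1, 3, 11, 7, 8, 10, 6, 2, 4, 12, 5, 9, 13]),
  ([7, 19, 22, 61, 93, 104, 117], [0, 1, 3, 11, 7, 8, 10, 2, 6, 4, 12, 5, 9, 13]),
  ([7, 21, 22, 59, 91, 104, 115], [0, 1, 3, 11, 7, 8, 10, 2, 4, 6, 12, 5, 9, 13]),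
  ([7, 35, 37, 62, 88, 110, 118], [0, 1, 3, 12, 7, 8, 10, 6, 2, 4, 11, 9, 5, 13]),
  ([7, 35, 38, 61, 88, 109, 117], [0, 1, 3, 12, 7, 8, 10, 2, 6, 4, 11, 9, 5, 13]),
  ([7, 37, 38, 59, 88, 107, 115], [0, 1, 3, 12, 7, 8, 10, 2, 4, 6, 11, 9, 5, 13]),
  ([7, 56, 67, 69, 94, 110, 118], [0, 7, 1, 3, 12, 8, 10, 6, 2, 4, 11, 9, 13, 5]),
  ([7, 56, 67, 70, 93, 109, 117], [0, 7, 1, 3, 12, 8, 10, 2, 6, 4, 11, 9, 13, 5]),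
  ([7, 56, 69, 70, 91, 107, 115], [0, 7, 1, 3, 12, 8, 10, 2, 4, 6, 11, 9, 13, 5]),
  ([7, 56, 88, 104, 115, 117, 118], [0, 7, 8, 10, 5, 1, 3, 4, 2, 6, 13, 9, 11, 12]),
  ([7, 56, 88, 107, 109, 110, 112], [0, 7, 8, 5, 1, 3, 10, 4, 2, 6, 9, 13, 11, 12]),
  ([7, 56, 91, 93, 94, 104, 112], [0, 7, 5, 1, 3, 8, 10, 4, 2, 6, 9, 11, 13, 12]),
  ([7, 59, 61, 62, 88, 104, 112], [0, 5, 1, 3, 7, 8, 10, 4, 2, 6, 9, 11, 12, 13]),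
  ([11, 13, 14, 55, 87, 103, 112], [0, 1, 3, 9, 7, 8, 10, 2, 4, 5, 6, 12, 11, 13]),
  ([11, 19, 25, 62, 94, 100, 122], [0, 1, 3, 11, 7, 8, 10, 6, 2, 12, 4, 5, 9, 13]),
  ([11, 19, 26, 61, 93, 100, 121], [0, 1, 3, 11, 7, 8, 10, 2, 6, 12, 4, 5, 9, 13]),
  ([11, 25, 26, 55, 87, 100, 115], [0, 1, 3, 11, 7, 8, 10, 2, 4, 12, 6, 5, 9, 13]),
  ([11, 35, 41, 62, 84, 110, 122], [0, 1, 3, 12, 7, 8, 10, 6, 2, 11, 4, 9, 5, 13]),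
  ([11, 35, 42, 61, 84, 109, 121], [0, 1, 3, 12, 7, 8, 10, 2, 6, 11, 4, 9, 5, 13]),
  ([11, 41, 42, 55, 84, 103, 115], [0, 1, 3, 12, 7, 8, 10, 2, 4, 11, 6, 9, 5, 13]),
  ([11, 52, 67, 73, 94, 110, 122], [0, 7, 1, 3, 12, 8, 10, 6, 2, 11, 4, 9, 13, 5]),
  ([11, 52, 67, 74, 93, 109, 121], [0, 7, 1, 3, 12, 8, 10, 2, 6, 11, 4, 9, 13, 5]),
  ([11, 52, 73, 74, 87, 103, 115], [0, 7, 1, 3, 12, 8, 10, 2, 4, 11, 6, 9, 13, 5]),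
  ([11, 52, 84, 100, 115, 121, 122], [0, 7, 8, 10, 5, 1, 3, 4, 2, 13, 6, 9, 11, 12]),
  ([11, 52, 84, 103, 109, 110, 112], [0, 7, 8, 5, 1, 3, 10, 4, 2, 9, 6, 13, 11, 12]),
  ([11, 52, 87, 93, 94, 100, 112], [0, 7, 5, 1, 3, 8, 10, 4, 2, 9, 6, 11, 13, 12]),
  ([11, 55, 61, 62, 84, 100, 112], [0, 5, 1, 3, 7, 8, 10, 4, 2, 9, 6, 11, 12, 13]),
  ([13, 21, 25, 62, 94, 98, 124], [0, 1, 3, 11, 7, 8, 10, 6, 12, 2, 4, 5, 9, 13]),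
  ([13, 21, 28, 59, 91, 98, 121], [0, 1, 3, 11, 7, 8, 10, 2, 12, 6, 4, 5, 9, 13]),
  ([13, 25, 28, 55, 87, 98, 117], [0, 1, 3, 11, 7, 8, 10, 2, 12, 4, 6, 5, 9, 13]),
  ([13, 37, 41, 62, 82, 110, 124], [0, 1, 3, 12, 7, 8, 10, 6, 11, 2, 4, 9, 5, 13]),
  ([13, 37, 44, 59, 82, 107, 121], [0, 1, 3, 12, 7, 8, 10, 2, 11, 6, 4, 9, 5, 13]),
  ([13, 41, 44, 55, 82, 103, 117], [0, 1, 3, 12, 7, 8, 10, 2, 11, 4, 6, 9, 5, 13]),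
  ([13, 50, 69, 73, 94, 110, 124], [0, 7, 1, 3, 12, 8, 10, 6, 11, 2, 4, 9, 13, 5]),
  ([13, 50, 69, 76, 91, 107, 121], [0, 7, 1, 3, 12, 8, 10, 2, 11, 6, 4, 9, 13, 5]),
  ([13, 50, 73, 76, 87, 103, 117], [0, 7, 1, 3, 12, 8, 10, 2, 11, 4, 6, 9, 13, 5]),
  ([13, 50, 82, 98, 117, 121, 124], [0, 7, 8, 10, 5, 1, 3, 4, 13, 2, 6, 9, 11, 12]),
  ([13, 50, 82, 103, 107, 110, 112], [0, 7, 8, 5, 1, 3, 10, 4, 9, 2, 6, 13, 11, 12]),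
  ([13, 50, 87, 91, 94, 98, 112], [0, 7, 5, 1, 3, 8, 10, 4, 9, 2, 6, 11, 13, 12]),
  ([13, 55, 59, 62, 82, 98, 112], [0, 5, 1, 3, 7, 8, 10, 4, 9, 2, 6, 11, 12, 13]),
  ([14, 22, 26, 61, 93, 97, 124], [0, 1, 3, 11, 7, 8, 10, 12, 6, 2, 4, 5, 9, 13]),
  ([14, 22, 28, 59, 91, 97, 122], [0, 1, 3, 11, 7, 8, 10, 12, 2, 6, 4, 5, 9, 13]),
  ([14, 26, 28, 55, 87, 97, 118], [0, 1, 3, 11, 7, 8, 10, 12, 2, 4, 6, 5, 9, 13]),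
  ([14, 38, 42, 61, 81, 109, 124], [0, 1, 3, 12, 7, 8, 10, 11, 6, 2, 4, 9, 5, 13]),
  ([14, 38, 44, 59, 81, 107, 122], [0, 1, 3, 12, 7, 8, 10, 11, 2, 6, 4, 9, 5, 13]),
  ([14, 42, 44, 55, 81, 103, 118], [0, 1, 3, 12, 7, 8, 10, 11, 2, 4, 6, 9, 5, 13]),
  ([14, 49, 70, 74, 93, 109, 124], [0, 7, 1, 3, 12, 8, 10, 11, 6, 2, 4, 9, 13, 5]),
  ([14, 49, 70, 76, 91, 107, 122], [0, 7, 1, 3, 12, 8, 10, 11, 2, 6, 4, 9, 13, 5]),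
  ([14, 49, 74, 76, 87, 103, 118], [0, 7, 1, 3, 12, 8, 10, 11, 2, 4, 6, 9, 13, 5]),
  ([14, 49, 81, 97, 118, 122, 124], [0, 7, 8, 10, 5, 1, 3, 13, 4, 2, 6, 9, 11, 12]),
  ([14, 49, 81, 103, 107, 109, 112], [0, 7, 8, 5, 1, 3, 10, 9, 4, 2, 6, 13, 11, 12]),
  ([14, 49, 87, 91, 93, 97, 112], [0, 7, 5, 1, 3, 8, 10, 9, 4, 2, 6, 11, 13, 12]),
  ([14, 55, 59, 61, 81, 97, 112], [0, 5, 1, 3, 7, 8, 10, 9, 4, 2, 6, 11, 12, 13]),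
  ([19, 21, 22, 47, 79, 103, 104], [0, 1, 3, 9, 7, 8, 10, 2, 4, 5, 12, 6, 11, 13]),
  ([19, 25, 26, 47, 79, 100, 107], [0, 1, 3, 11, 7, 8, 10, 2, 4, 12, 5, 6, 9, 13]),
  ([19, 35, 49, 62, 76, 118, 122], [0, 1, 3, 12, 7, 8, 10, 6, 2, 11, 9, 4, 5, 13]),
  ([19, 35, 50, 61, 76, 117, 121], [0, 1, 3, 12, 7, 8, 10, 2, 6, 11, 9, 4, 5, 13]),
  ([19, 44, 67, 81, 94, 118, 122], [0, 7, 1, 3, 12, 8, 10, 6, 2, 11, 9, 4, 13, 5]),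
  ([19, 44, 67, 82, 93, 117, 121], [0, 7, 1, 3, 12, 8, 10, 2, 6, 11, 9, 4, 13, 5]),
  ([19, 44, 76, 100, 107, 121, 122], [0, 7, 8, 10, 5, 1, 3, 4, 2, 13, 9, 6, 11, 12]),
  ([19, 44, 76, 103, 104, 117, 118], [0, 7, 8, 5, 10, 1, 3, 4, 2, 9, 13, 6, 11, 12]),
  ([19, 44, 79, 81, 82, 103, 107], [0, 7, 12, 1, 3, 8, 10, 2, 4, 11, 9, 6, 13, 5]),
  ([19, 44, 79, 93, 94, 100, 104], [0, 7, 5, 1, 3, 8, 10, 4, 2, 9, 11, 6, 13, 12]),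
  ([19, 47, 49, 50, 76, 103, 107], [0, 12, 1, 3, 7, 8, 10, 2, 4, 11, 9, 6, 5, 13]),
  ([19, 47, 61, 62, 76, 100, 104], [0, 5, 1, 3, 7, 8, 10, 4, 2, 9, 11, 6, 12, 13]),
  ([21, 25, 28, 47, 79, 98, 109], [0, 1, 3, 11, 7, 8, 10, 2, 12, 4, 5, 6, 9, 13]),
  ([21, 37, 49, 62, 74, 118, 124], [0, 1, 3, 12, 7, 8, 10, 6, 11, 2, 9, 4, 5, 13]),
  ([21, 37, 52, 59, 74, 115, 121], [0, 1, 3, 12, 7, 8, 10, 2, 11, 6, 9, 4, 5, 13]),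
  ([21, 42, 69, 81, 94, 118, 124], [0, 7, 1, 3, 12, 8, 10, 6, 11, 2, 9, 4, 13, 5]),
  ([21, 42, 69, 84, 91, 115, 121], [0, 7, 1, 3, 12, 8, 10, 2, 11, 6, 9, 4, 13, 5]),
  ([21, 42, 74, 98, 109, 121, 124], [0, 7, 8, 10, 5, 1, 3, 4, 13, 2, 9, 6, 11, 12]),
  ([21, 42, 74, 103, 104, 115, 118], [0, 7, 8, 5, 10, 1, 3, 4, 9, 2, 13, 6, 11, 12]),
  ([21, 42, 79, 81, 84, 103, 109], [0, 7, 12, 1, 3, 8, 10, 2, 11, 4, 9, 6, 13, 5]),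
  ([21, 42, 79, 91, 94, 98, 104], [0, 7, 5, 1, 3, 8, 10, 4, 9, 2, 11, 6, 13, 12]),
  ([21, 47, 49, 52, 74, 103, 109], [0, 12, 1, 3, 7, 8, 10, 2, 11, 4, 9, 6, 5, 13]),
  ([21, 47, 59, 62, 74, 98, 104], [0, 5, 1, 3, 7, 8, 10, 4, 9, 2, 11, 6, 12, 13]),
  ([22, 26, 28, 47, 79, 97, 110], [0, 1, 3, 11, 7, 8, 10, 12, 2, 4, 5, 6, 9, 13]),
  ([22, 38, 50, 61, 73, 117, 124], [0, 1, 3, 12, 7, 8, 10, 11, 6, 2, 9, 4, 5, 13]),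
  ([22, 38, 52, 59, 73, 115, 122], [0, 1, 3, 12, 7, 8, 10, 11, 2, 6, 9, 4, 5, 13]),
  ([22, 41, 70, 82, 93, 117, 124], [0, 7, 1, 3, 12, 8, 10, 11, 6, 2, 9, 4, 13, 5]),
  ([22, 41, 70, 84, 91, 115, 122], [0, 7, 1, 3, 12, 8, 10, 11, 2, 6, 9, 4, 13, 5]),
  ([22, 41, 73, 97, 110, 122, 124], [0, 7, 8, 10, 5, 1, 3, 13, 4, 2, 9, 6, 11, 12]),
  ([22, 41, 73, 103, 104, 115, 117], [0, 7, 8, 5, 10, 1, 3, 9, 4, 2, 13, 6, 11, 12]),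
  ([22, 41, 79, 82, 84, 103, 110], [0, 7, 12, 1, 3, 8, 10, 11, 2, 4, 9, 6, 13, 5]),
  ([22, 41, 79, 91, 93, 97, 104], [0, 7, 5, 1, 3, 8, 10, 9, 4, 2, 11, 6, 13, 12]),
  ([22, 47, 50, 52, 73, 103, 110], [0, 12, 1, 3, 7, 8, 10, 11, 2, 4, 9, 6, 5, 13]),
  ([22, 47, 59, 61, 73, 97, 104], [0, 5, 1, 3, 7, 8, 10, 9, 4, 2, 11, 6, 12, 13]),
  ([25, 38, 70, 98, 109, 117, 124], [0, 7, 8, 10, 5, 1, 3, 4, 13, 9, 2, 6, 11, 12]),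
  ([25, 38, 70, 100, 107, 115, 122], [0, 7, 8, 10, 5, 1, 3, 4, 9, 13, 2, 6, 11, 12]),
  ([25, 38, 73, 81, 94, 122, 124], [0, 7, 1, 3, 12, 8, 10, 6, 11, 9, 2, 4, 13, 5]),
  ([25, 38, 73, 87, 88, 115, 117], [0, 7, 1, 12, 3, 8, 10, 2, 11, 9, 6, 4, 13, 5]),
  ([25, 38, 79, 81, 88, 107, 109], [0, 7, 12, 1, 3, 8, 10, 2, 11, 9, 4, 6, 13, 5]),
  ([25, 38, 79, 87, 94, 98, 100], [0, 7, 5, 1, 3, 8, 10, 4, 9, 11, 2, 6, 13, 12]),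
  ([25, 41, 49, 62, 70, 122, 124], [0, 1, 3, 12, 7, 8, 10, 6, 11, 9, 2, 4, 5, 13]),
  ([25, 41, 55, 56, 70, 115, 117], [0, 1, 12, 3, 7, 8, 10, 2, 11, 9, 6, 4, 5, 13]),
  ([25, 47, 49, 56, 70, 107, 109], [0, 12, 1, 3, 7, 8, 10, 2, 11, 9, 4, 6, 5, 13]),
  ([25, 47, 55, 62, 70, 98, 100], [0, 5, 1, 3, 7, 8, 10, 4, 9, 11, 2, 6, 12, 13]),
  ([26, 37, 69, 97, 110, 118, 124], [0, 7, 8, 10, 5, 1, 3, 13, 4, 9, 2, 6, 11, 12]),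
  ([26, 37, 69, 100, 107, 115, 121], [0, 7, 8, 10, 5, 1, 3, 9, 4, 13, 2, 6, 11, 12]),
  ([26, 37, 74, 82, 93, 121, 124], [0, 7, 1, 3, 12, 8, 10, 11, 6, 9, 2, 4, 13, 5]),
  ([26, 37, 74, 87, 88, 115, 118], [0, 7, 1, 12, 3, 8, 10, 11, 2, 9, 6, 4, 13, 5]),
  ([26, 37, 79, 82, 88, 107, 110], [0, 7, 12, 1, 3, 8, 10, 11, 2, 9, 4, 6, 13, 5]),
  ([26, 37, 79, 87, 93, 97, 100], [0, 7, 5, 1, 3, 8, 10, 9, 4, 11, 2, 6, 13, 12]),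
  ([26, 42, 50, 61, 69, 121, 124], [0, 1, 3, 12, 7, 8, 10, 11, 6, 9, 2, 4, 5, 13]),
  ([26, 42, 55, 56, 69, 115, 118], [0, 1, 12, 3, 7, 8, 10, 11, 2, 9, 6, 4, 5, 13]),
  ([26, 47, 50, 56, 69, 107, 110], [0, 12, 1, 3, 7, 8, 10, 11, 2, 9, 4, 6, 5, 13]),
  ([26, 47, 55, 61, 69, 97, 100], [0, 5, 1, 3, 7, 8, 10, 9, 4, 11, 2, 6, 12, 13]),
  ([28, 35, 67, 97, 110, 118, 122], [0, 7, 8, 10, 5, 1, 3, 13, 9, 4, 2, 6, 11, 12]),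
  ([28, 35, 67, 98, 109, 117, 121], [0, 7, 8, 10, 5, 1, 3, 9, 13, 4, 2, 6, 11, 12]),
  ([28, 35, 76, 84, 91, 121, 122], [0, 7, 1, 3, 12, 8, 10, 11, 9, 6, 2, 4, 13, 5]),
  ([28, 35, 76, 87, 88, 117, 118], [0, 7, 1, 12, 3, 8, 10, 11, 9, 2, 6, 4, 13, 5]),
  ([28, 35, 79, 84, 88, 109, 110], [0, 7, 12, 1, 3, 8, 10, 11, 9, 2, 4, 6, 13, 5]),
  ([28, 35, 79, 87, 91, 97, 98], [0, 7, 5, 1, 3, 8, 10, 9, 11, 4, 2, 6, 13, 12]),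
  ([28, 44, 52, 59, 67, 121, 122], [0, 1, 3, 12, 7, 8, 10, 11, 9, 6, 2, 4, 5, 13]),
  ([28, 44, 55, 56, 67, 117, 118], [0, 1, 12, 3, 7, 8, 10, 11, 9, 2, 6, 4, 5, 13]),
  ([28, 47, 52, 56, 67, 109, 110], [0, 12, 1, 3, 7, 8, 10, 11, 9, 2, 4, 6, 5, 13]),
  ([28, 47, 55, 59, 67, 97, 98], [0, 5, 1, 3, 7, 8, 10, 9, 11, 4, 2, 6, 12, 13]),
  ([31, 35, 37, 38, 79, 87, 88], [9, 0, 1, 3, 7, 8, 10, 2, 4, 5, 12, 11, 6, 13]),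
  ([31, 35, 41, 42, 79, 84, 91], [11, 0, 1, 3, 7, 8, 10, 2, 4, 12, 5, 9, 6, 13]),
  ([31, 35, 49, 50, 76, 87, 91], [12, 0, 1, 3, 7, 8, 10, 2, 4, 11, 9, 5, 6, 13]),
  ([31, 35, 61, 62, 76, 84, 88], [5, 0, 1, 3, 7, 8, 10, 4, 2, 9, 11, 12, 6, 13]),
  ([31, 37, 41, 44, 79, 82, 93], [11, 0, 1, 3, 7, 8, 10, 2, 12, 4, 5, 9, 6, 13]),
  ([31, 37, 49, 52, 74, 87, 93], [12, 0, 1, 3, 7, 8, 10, 2, 11, 4, 9, 5, 6, 13]),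
  ([31, 37, 59, 62, 74, 82, 88], [5, 0, 1, 3, 7, 8, 10, 4, 9, 2, 11, 12, 6, 13]),
  ([31, 38, 42, 44, 79, 81, 94], [11, 0, 1, 3, 7, 8, 10, 12, 2, 4, 5, 9, 6, 13]),
  ([31, 38, 50, 52, 73, 87, 94], [12, 0, 1, 3, 7, 8, 10, 11, 2, 4, 9, 5, 6, 13]),
  ([31, 38, 59, 61, 73, 81, 88], [5, 0, 1, 3, 7, 8, 10, 9, 4, 2, 11, 12, 6, 13]),
  ([31, 41, 49, 56, 70, 91, 93], [12, 0, 1, 3, 7, 8, 10, 2, 11, 9, 4, 5, 6, 13]),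
  ([31, 41, 55, 62, 70, 82, 84], [5, 0, 1, 3, 7, 8, 10, 4, 9, 11, 2, 12, 6, 13]),
  ([31, 42, 50, 56, 69, 91, 94], [12, 0, 1, 3, 7, 8, 10, 11, 2, 9, 4, 5, 6, 13]),
  ([31, 42, 55, 61, 69, 81, 84], [5, 0, 1, 3, 7, 8, 10, 9, 4, 11, 2, 12, 6, 13]),
  ([31, 44, 52, 56, 67, 93, 94], [12, 0, 1, 3, 7, 8, 10, 11, 9, 2, 4, 5, 6, 13]),
  ([31, 44, 55, 59, 67, 81, 82], [5, 0, 1, 3, 7, 8, 10, 9, 11, 4, 2, 12, 6, 13]),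
  ([31, 47, 49, 62, 70, 74, 76], [4, 0, 1, 3, 7, 8, 10, 5, 9, 11, 12, 2, 6, 13]),
  ([31, 47, 50, 61, 69, 73, 76], [4, 0, 1, 3, 7, 8, 10, 9, 5, 11, 12, 2, 6, 13]),
  ([31, 47, 52, 59, 67, 73, 74], [4, 0, 1, 3, 7, 8, 10, 9, 11, 5, 12, 2, 6, 13]),
  ([31, 47, 55, 56, 67, 69, 70], [2, 0, 1, 3, 7, 8, 10, 9, 11, 12, 5, 4, 6, 13])]

def search : ℕ → ℕ → List ℕ → List ℕ → Bool
  | _, 0, _, ch => sols.any fun t => listEq t.1 ch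
  | 0, _ + 1, _, _ => false
  | _ + 1, _ + 1, [], _ => true
  | f + 1, d + 1, x :: xs, ch =>
    search f (d + 1) xs ch && search f d (xs.filter (orth x)) (ch ++ [x])

set_option maxRecDepth 100000 in
theorem search_ok : search 60 7 cands [] = true := by decide +kernel

set_option maxRecDepth 100000 in
theorem sols_ok : (sols.all fun t => goodPerm (gensFrom 1 t.1) t.2) = true := by decide +kernel

theorem listEq_eq : ∀ l l' : List ℕ, listEq l l' = true → l = l'
  | [], [], _ => rfl
  | x :: l, y :: l', h => by
    simp only [listEq, Bool.and_eq_true] at h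
    rw [Nat.eq_of_beq_eq_true h.1, listEq_eq l l' h.2]
  | [], _ :: _, h => by simp [listEq] at h
  | _ :: _, [], h => by simp [listEq] at h

theorem search_sound : ∀ (f d : ℕ) (cs ch l : List ℕ), search f d cs ch = true →
    l.Sublist cs → l.length = d → l.Pairwise (fun x y => orth x y = true) →
    ∃ t ∈ sols, t.1 = ch ++ l := by
  have key : ∀ (f : ℕ) (cs ch l : List ℕ), search f 0 cs ch = true → l.length = 0 →
      ∃ t ∈ sols, t.1 = ch ++ l := by
    intro f cs ch l h hl
    have hl' : l = [] := List.eq_nil_of_length_eq_zero hl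
    subst hl'
    have h2 : (sols.any fun t => listEq t.1 ch) = true := by
      cases f <;> simpa only [search] using h
    obtain ⟨t, ht, h3⟩ := List.any_eq_true.1 h2
    exact ⟨t, ht, by simpa using listEq_eq _ _ h3⟩
  intro f
  induction f with
  | zero =>
    intro d cs ch l h hs hl hp
    cases d with
    | zero => exact key _ _ _ _ h hl
    | succ d => simp [search] at h
  | succ f ih =>
    intro d cs ch l h hs hl hp
    cases d with
    | zero => exact key _ _ _ _ h hl
    | succ d =>
      cases cs with
      | nil =>
        have : l = [] := List.eq_nil_of_sublist_nil hs
        subst this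
        simp at hl
      | cons x xs =>
        simp only [search, Bool.and_eq_true] at h
        cases hs with
        | cons _ hs => exact ih _ _ _ _ h.1 hs hl hp
        | cons_cons _ hs =>
          rename_i l'
          rw [List.pairwise_cons] at hp
          have h4 : l'.Sublist (xs.filter (orth x)) := by
            have := hs.filter (orth x)
            rwa [List.filter_eq_self.2 hp.1] at this
          obtain ⟨t, ht, h5⟩ := ih _ _ _ _ h.2 h4 (by simpa using hl) hp.2
          exact ⟨t, ht, by rw [h5]; simp⟩

/-- The bit mask of a binary vector. -/
def msk {n : ℕ} (v : Fin n → ZMod 2) : ℕ := Nat.ofBits fun i => decide (v i ≠ 0)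

theorem shift_mod (n k : ℕ) : (n >>> k) % 2 = (n.testBit k).toNat := by
  rw [Nat.toNat_testBit, Nat.shiftRight_eq_div_pow]

theorem pcnt_eq (n : ℕ) : pcnt n = ∑ i : Fin 14, (n.testBit i).toNat := by
  simp only [pcnt, shift_mod, Fin.sum_univ_succ]
  simp [add_assoc]

theorem pcnt_lt (n : ℕ) (h : n < 2 ^ 7) : pcnt n = ∑ i : Fin 7, (n.testBit i).toNat := by
  rw [pcnt_eq, Fin.sum_univ_add (a := 7) (b := 7)]
  have : ∀ i : Fin 7, n.testBit (Fin.natAdd 7 i : Fin 14) = false := fun i =>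
    Nat.testBit_lt_two_pow (lt_of_lt_of_le h (Nat.pow_le_pow_right (by norm_num) (by simp)))
  have h0 : ∑ i : Fin 7, (n.testBit (Fin.natAdd 7 i : Fin 14)).toNat = 0 :=
    Finset.sum_eq_zero fun i _ => by rw [this i]; rfl
  rw [h0, add_zero]
  rfl

theorem msk_testBit {n : ℕ} (v : Fin n → ZMod 2) (i : Fin n) :
    (msk v).testBit i = decide (v i ≠ 0) := by
  simp [msk]

theorem zmod2_toNat (a : ZMod 2) : (((decide (a ≠ 0)).toNat : ℕ) : ZMod 2) = a := by
  revert a; decide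

theorem zmod2_mul_toNat (a b : ZMod 2) :
    (((decide (a ≠ 0) && decide (b ≠ 0)).toNat : ℕ) : ZMod 2) = a * b := by
  revert a b; decide

theorem wt_eq_sum_s7 {n : ℕ} (v : Fin n → ZMod 2) : wt v = ∑ i : Fin n, ((msk v).testBit i).toNat := by
  simp only [msk_testBit, wt, Finset.card_filter]
  apply Finset.sum_congr rfl
  intro i _
  by_cases h : v i = 0 <;> simp [h]

theorem inner_eq_sum {n : ℕ} (v w : Fin n → ZMod 2) :
    inner2 v w = ((∑ i : Fin n, ((msk v &&& msk w).testBit i).toNat : ℕ) : ZMod 2) := by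
  simp only [Nat.testBit_and, msk_testBit, inner2, Nat.cast_sum, zmod2_mul_toNat]

theorem msk_lt {n : ℕ} (v : Fin n → ZMod 2) : msk v < 2 ^ n := Nat.ofBits_lt_two_pow _

theorem wt_mod {n : ℕ} (v : Fin n → ZMod 2) : ((wt v : ℕ) : ZMod 2) = inner2 v v := by
  rw [wt_eq_sum_s7, inner_eq_sum, Nat.and_self]

/-- The code with permuted coordinates. -/
def pcode (A : Submodule (ZMod 2) (Fin 14 → ZMod 2)) (e : Equiv.Perm (Fin 14)) :
    Submodule (ZMod 2) (Fin 14 → ZMod 2) :=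
  A.comap (LinearMap.funLeft (ZMod 2) (ZMod 2) e)

theorem mem_pcode {A : Submodule (ZMod 2) (Fin 14 → ZMod 2)} {e : Equiv.Perm (Fin 14)}
    {v : Fin 14 → ZMod 2} : v ∈ pcode A e ↔ v ∘ e ∈ A := Iff.rfl

theorem inner2_comp (v w : Fin 14 → ZMod 2) (e : Equiv.Perm (Fin 14)) :
    inner2 (v ∘ e) (w ∘ e) = inner2 v w := by
  simp only [inner2, Function.comp]
  exact Equiv.sum_comp e (fun i => v i * w i)

theorem mem_iff {A : Submodule (ZMod 2) (Fin 14 → ZMod 2)} (hA : IsSelfDual A)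
    (v : Fin 14 → ZMod 2) : v ∈ A ↔ ∀ c ∈ A, inner2 v c = 0 := by
  have : v ∈ (A : Set (Fin 14 → ZMod 2)) ↔ v ∈ {v | ∀ c ∈ A, inner2 v c = 0} := by
    rw [← hA]
  exact this

theorem pcode_selfDual {A : Submodule (ZMod 2) (Fin 14 → ZMod 2)} (hA : IsSelfDual A)
    (e : Equiv.Perm (Fin 14)) : IsSelfDual (pcode A e) := by
  ext v
  change v ∘ e ∈ A ↔ ∀ c ∈ pcode A e, inner2 v c = 0
  rw [mem_iff hA]
  constructor
  · intro h c hc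
    rw [← inner2_comp v c e]
    exact h _ hc
  · intro h c hc
    have := h (c ∘ e.symm) (by rw [mem_pcode]; convert hc using 1; ext; simp)
    rw [← inner2_comp v _ e] at this
    convert this using 2
    ext; simp

theorem wt_comp (v : Fin 14 → ZMod 2) (e : Equiv.Perm (Fin 14)) : wt (v ∘ e) = wt v := by
  simp only [wt, Finset.card_filter, Function.comp]
  exact Equiv.sum_comp e (fun i => if v i ≠ 0 then 1 else 0)

theorem pcode_min {A : Submodule (ZMod 2) (Fin 14 → ZMod 2)}
    (hA : ∀ a ∈ A, a ≠ 0 → 4 ≤ wt a) (e : Equiv.Perm (Fin 14)) :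
    ∀ a ∈ pcode A e, a ≠ 0 → 4 ≤ wt a := by
  intro a ha h0
  rw [← wt_comp a e]
  refine hA _ ha fun h => h0 ?_
  ext i
  have := congrFun h (e.symm i)
  simpa using this

theorem finrank_seven {A : Submodule (ZMod 2) (Fin 14 → ZMod 2)} (hA : IsSelfDual A) :
    Module.finrank (ZMod 2) A = 7 := by
  let B : LinearMap.BilinForm (ZMod 2) (Fin 14 → ZMod 2) := Matrix.toBilin' 1
  have hB : B.Nondegenerate := by
    apply Matrix.nondegenerate_toBilin'_iff.2
    exact Matrix.nondegenerate_of_det_ne_zero (by simp)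
  have h1 : B.orthogonal A = A := by
    ext v
    rw [LinearMap.BilinForm.mem_orthogonal_iff, mem_iff hA]
    refine forall₂_congr fun c _ => ?_
    have : B c v = inner2 v c := by
      simp [B, Matrix.toBilin'_apply', inner2, dotProduct, mul_comm]
    rw [this]
  have h2 := LinearMap.BilinForm.finrank_orthogonal hB A
  rw [h1] at h2
  have h3 : Module.finrank (ZMod 2) A ≤ Module.finrank (ZMod 2) (Fin 14 → ZMod 2) :=
    Submodule.finrank_le A
  rw [Module.finrank_fin_fun] at h2 h3
  omega

/-- An information set. -/
theorem exists_info {A : Submodule (ZMod 2) (Fin 14 → ZMod 2)} (hA : IsSelfDual A) :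
    ∃ i : Fin 7 → Fin 14, Function.Injective i ∧ ∀ v ∈ A, (∀ k, v (i k) = 0) → v = 0 := by
  let φ : Fin 14 → Module.Dual (ZMod 2) A := fun i => (LinearMap.proj i).comp A.subtype
  obtain ⟨κ, a, ha, hsp, hli⟩ := exists_linearIndependent' (ZMod 2) φ
  have key : ∀ v : A, (∀ k, φ (a k) v = 0) → v = 0 := by
    intro v hv
    have h1 : ∀ ψ ∈ Submodule.span (ZMod 2) (Set.range (φ ∘ a)), ψ v = 0 := by
      intro ψ hψ
      induction hψ using Submodule.span_induction with
      | mem x hx => obtain ⟨k, rfl⟩ := hx; exact hv k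
      | zero => simp
      | add x y _ _ hx hy => simp [hx, hy]
      | smul c x _ hx => simp [hx]
    rw [hsp] at h1
    ext i
    exact h1 (φ i) (Submodule.subset_span ⟨i, rfl⟩)
  have : Finite κ := Finite.of_injective a ha
  have := Fintype.ofFinite κ
  have c1 : Fintype.card κ ≤ 7 := by
    have := hli.fintype_card_le_finrank
    rwa [Subspace.dual_finrank_eq, finrank_seven hA] at this
  have c2 : 7 ≤ Fintype.card κ := by
    let R : A →ₗ[ZMod 2] (κ → ZMod 2) := LinearMap.pi fun k => φ (a k)
    have hR : Function.Injective R := by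
      rw [← LinearMap.ker_eq_bot, LinearMap.ker_eq_bot']
      intro v hv
      exact key v fun k => congrFun hv k
    have := LinearMap.finrank_le_finrank_of_injective hR
    rwa [finrank_seven hA, Module.finrank_fintype_fun_eq_card] at this
  have e : Fin 7 ≃ κ := (Fintype.equivFinOfCardEq (le_antisymm c1 c2)).symm
  refine ⟨a ∘ e, ha.comp e.injective, fun v hv h => ?_⟩
  have := key ⟨v, hv⟩ fun k => by
    have := h (e.symm k)
    simpa [φ] using this
  simpa using this

theorem exists_perm_extend (i : Fin 7 → Fin 14) (hi : Function.Injective i) :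
    ∃ e : Equiv.Perm (Fin 14), ∀ k : Fin 7, e (i k) = Fin.castAdd 7 k := by
  have h := Equiv.Perm.exists_extending_pair i (Fin.castAdd 7) hi (Fin.castAdd_injective 7 7)
  exact h

/-- A system of generators in systematic form. -/
def Sys (C : Submodule (ZMod 2) (Fin 14 → ZMod 2)) (g : Fin 7 → Fin 14 → ZMod 2) : Prop :=
  (∀ k, g k ∈ C) ∧ (∀ k l : Fin 7, g k (Fin.castAdd 7 l) = if k = l then 1 else 0) ∧
    ∀ v ∈ C, (∀ k : Fin 7, v (Fin.castAdd 7 k) = 0) → v = 0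

theorem exists_sys {A : Submodule (ZMod 2) (Fin 14 → ZMod 2)} (hA : IsSelfDual A) :
    ∃ e g, Sys (pcode A e) g := by
  obtain ⟨i, hi, hz⟩ := exists_info hA
  obtain ⟨e, he⟩ := exists_perm_extend i hi
  have hz' : ∀ v ∈ pcode A e, (∀ k : Fin 7, v (Fin.castAdd 7 k) = 0) → v = 0 := by
    intro v hv h
    have := hz _ hv fun k => by simp [he, h]
    ext j
    have := congrFun this (e.symm j)
    simpa using this
  let R : pcode A e →ₗ[ZMod 2] (Fin 7 → ZMod 2) :=
    LinearMap.pi fun k => (LinearMap.proj (Fin.castAdd 7 k)).comp (pcode A e).subtype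
  have hR : Function.Injective R := by
    rw [← LinearMap.ker_eq_bot, LinearMap.ker_eq_bot']
    intro v hv
    exact Subtype.ext (hz' v v.2 fun k => congrFun hv k)
  have hR' : Function.Surjective R := by
    refine (LinearMap.injective_iff_surjective_of_finrank_eq_finrank ?_).1 hR
    rw [finrank_seven (pcode_selfDual hA e), Module.finrank_fin_fun]
  choose g hg using fun k : Fin 7 => hR' (Pi.single k 1)
  refine ⟨e, fun k => g k, fun k => (g k).2, fun k l => ?_, hz'⟩
  have := congrFun (hg k) l
  simp only [R, LinearMap.pi_apply] at this
  simpa [Pi.single_apply, eq_comm] using this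

/-- The right half of a word. -/
def rt (v : Fin 14 → ZMod 2) : Fin 7 → ZMod 2 := fun j => v (Fin.natAdd 7 j)

theorem exists_sorted {A : Submodule (ZMod 2) (Fin 14 → ZMod 2)} (hA : IsSelfDual A) :
    ∃ e g, Sys (pcode A e) g ∧ Monotone fun k => msk (rt (g k)) := by
  obtain ⟨e, g, h1, h2, h3⟩ := exists_sys hA
  let s : Equiv.Perm (Fin 7) := Tuple.sort fun k => msk (rt (g k))
  have hs : Monotone ((fun k => msk (rt (g k))) ∘ s) := Tuple.monotone_sort _
  let t : Equiv.Perm (Fin 14) := 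
    (finSumFinEquiv (m := 7) (n := 7)).symm.trans
      ((Equiv.sumCongr s (Equiv.refl _)).trans finSumFinEquiv)
  have tl : ∀ k : Fin 7, t (Fin.castAdd 7 k) = Fin.castAdd 7 (s k) := by
    intro k
    exact congrArg (fun z => finSumFinEquiv (Sum.map s (Equiv.refl (Fin 7)) z))
      (finSumFinEquiv_symm_apply_castAdd (m := 7) (n := 7) k)
  have tr : ∀ k : Fin 7, t (Fin.natAdd 7 k) = Fin.natAdd 7 k := by
    intro k
    exact congrArg (fun z => finSumFinEquiv (Sum.map s (Equiv.refl (Fin 7)) z))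
      (finSumFinEquiv_symm_apply_natAdd (m := 7) (n := 7) k)
  have mem : ∀ v, v ∈ pcode A (e.trans t.symm) ↔ v ∘ t.symm ∈ pcode A e := by
    intro v; rfl
  refine ⟨e.trans t.symm, fun k => g (s k) ∘ t, ⟨fun k => ?_, fun k l => ?_, fun v hv hv0 => ?_⟩, ?_⟩
  · rw [mem]
    convert h1 (s k) using 1
    ext; simp
  · simp [tl, h2]
  · rw [mem] at hv
    have := h3 _ hv fun k => by
      have : t.symm (Fin.castAdd 7 k) = Fin.castAdd 7 (s.symm k) := by
        rw [Equiv.symm_apply_eq, tl]; simp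
      simp [this, hv0]
    ext j
    have := congrFun this (t j)
    simpa using this
  · have : (fun k => msk (rt (g (s k) ∘ t))) = (fun k => msk (rt (g k))) ∘ s := by
      ext k
      simp only [Function.comp_apply]
      congr 1
      ext j
      simp only [rt, Function.comp_apply, tr]
    rw [this]
    exact hs

theorem sys_mem {C : Submodule (ZMod 2) (Fin 14 → ZMod 2)} (hC : IsSelfDual C)
    {g : Fin 7 → Fin 14 → ZMod 2} (hg : Sys C g) (v : Fin 14 → ZMod 2)
    (hv : ∀ k, inner2 v (g k) = 0) : v ∈ C := by
  rw [mem_iff hC]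
  intro c hc
  have h1 : c = ∑ k : Fin 7, c (Fin.castAdd 7 k) • g k := by
    rw [← sub_eq_zero]
    refine hg.2.2 _ (C.sub_mem hc (C.sum_mem fun k _ => C.smul_mem _ (hg.1 k))) fun k => ?_
    simp [hg.2.1]
  rw [h1]
  simp only [inner2, Finset.sum_apply, Pi.smul_apply, smul_eq_mul, Finset.mul_sum]
  rw [Finset.sum_comm]
  refine Finset.sum_eq_zero fun k _ => ?_
  have := hv k
  simp only [inner2] at this
  calc _ = c (Fin.castAdd 7 k) * ∑ i, v i * g k i := by
        rw [Finset.mul_sum]; exact Finset.sum_congr rfl fun i _ => by ring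
    _ = 0 := by rw [this, mul_zero]

theorem inner2_split (v w : Fin 14 → ZMod 2) :
    inner2 v w = ∑ k : Fin 7, v (Fin.castAdd 7 k) * w (Fin.castAdd 7 k) + inner2 (rt v) (rt w) := by
  unfold inner2
  exact Fin.sum_univ_add (a := 7) (b := 7) (fun i => v i * w i)

theorem wt_split (v : Fin 14 → ZMod 2) :
    wt v = (∑ k : Fin 7, if v (Fin.castAdd 7 k) ≠ 0 then 1 else 0) + wt (rt v) := by
  simp only [wt, Finset.card_filter]
  exact Fin.sum_univ_add (a := 7) (b := 7) (fun i => if v i ≠ 0 then 1 else 0)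

theorem pcnt_msk (v : Fin 7 → ZMod 2) : pcnt (msk v) = wt v := by
  rw [pcnt_lt _ (msk_lt v), wt_eq_sum_s7]

theorem orth_msk (v w : Fin 7 → ZMod 2) (h : inner2 v w = 0) : orth (msk v) (msk w) = true := by
  rw [inner_eq_sum, ← pcnt_lt _ (lt_of_le_of_lt Nat.and_le_left (msk_lt v)),
    ZMod.natCast_eq_zero_iff] at h
  unfold orth
  rw [Nat.mod_eq_zero_of_dvd h]
  rfl

theorem msk_split (v : Fin 14 → ZMod 2) :
    msk v = 128 * msk (rt v) + msk (fun k : Fin 7 => v (Fin.castAdd 7 k)) := by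
  simp only [msk, Nat.ofBits_succ, rt, Function.comp_def, Nat.ofBits_zero]
  simp only [Fin.succ, Fin.natAdd, Fin.castAdd, Fin.castLE]
  norm_num
  ring

theorem row_props {C : Submodule (ZMod 2) (Fin 14 → ZMod 2)} (hC : IsSelfDual C)
    (hmin : ∀ a ∈ C, a ≠ 0 → 4 ≤ wt a)
    {g : Fin 7 → Fin 14 → ZMod 2} (hg : Sys C g) :
    (∀ k, msk (rt (g k)) ∈ cands) ∧
      ∀ k l, k ≠ l → inner2 (rt (g k)) (rt (g l)) = 0 := by
  have hin : ∀ k l, inner2 (g k) (g l) = 0 := fun k l => (mem_iff hC _).1 (hg.1 k) _ (hg.1 l)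
  refine ⟨fun k => ?_, fun k l hkl => ?_⟩
  · have hw : wt (g k) = 1 + wt (rt (g k)) := by
      rw [wt_split]; simp [hg.2.1]
    have h0 : g k ≠ 0 := fun h => by
      have := hg.2.1 k k
      simp [h] at this
    have h4 := hmin _ (hg.1 k) h0
    have he : ((wt (g k) : ℕ) : ZMod 2) = 0 := by rw [wt_mod, hin]
    rw [ZMod.natCast_eq_zero_iff] at he
    have hlt := msk_lt (rt (g k))
    simp only [cands, List.mem_filter, List.mem_range, Bool.and_eq_true, Nat.ble_eq, pcnt_msk]
    refine ⟨hlt, ?_, by omega⟩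
    have : wt (rt (g k)) % 2 = 1 := by omega
    rw [this]; rfl
  · have := hin k l
    rw [inner2_split] at this
    simpa [hg.2.1, hkl] using this

theorem mem_gens {C : Submodule (ZMod 2) (Fin 14 → ZMod 2)}
    {g : Fin 7 → Fin 14 → ZMod 2} (hg : Sys C g) (k : Fin 7) :
    msk (g k) ∈ gensFrom 1 (List.ofFn fun k => msk (rt (g k))) := by
  have h1 : msk (g k) = 128 * msk (rt (g k)) + 2 ^ (k : ℕ) := by
    rw [msk_split]
    congr 1
    simp only [hg.2.1]
    fin_cases k <;> decide
  rw [h1]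
  simp only [List.ofFn_succ, gensFrom]
  fin_cases k <;> simp

/-- The vector of a bit mask. -/
def stdv (s : ℕ) : Fin 14 → ZMod 2 := fun i => ((s.testBit i).toNat : ZMod 2)

theorem dotp_eq (s g : ℕ) : ∀ (n q : ℕ) (f : Fin n → ℕ),
    (((dotp s g q (List.ofFn f)).toNat : ℕ) : ZMod 2) =
      ∑ i : Fin n, ((s.testBit (f i)).toNat : ZMod 2) * ((g.testBit (q + i)).toNat : ZMod 2)
  | 0, q, f => by simp [dotp]
  | n + 1, q, f => by
    have hx : ∀ a b c : Bool, (((xor (a && b) c).toNat : ℕ) : ZMod 2) =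
      (a.toNat : ZMod 2) * (b.toNat : ZMod 2) + (c.toNat : ZMod 2) := by decide
    rw [List.ofFn_succ, dotp, hx, dotp_eq s g n (q + 1), Fin.sum_univ_succ]
    simp [add_comm, add_left_comm]

theorem exists_std {A : Submodule (ZMod 2) (Fin 14 → ZMod 2)} (hA : IsSelfDual A)
    (hmin : ∀ a ∈ A, a ≠ 0 → 4 ≤ wt a) :
    ∃ σ : Equiv.Perm (Fin 14), ∀ s ∈ stdWords, stdv s ∈ pcode A σ := by
  obtain ⟨e, g, hg, hmono⟩ := exists_sorted hA
  have hC := pcode_selfDual hA e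
  obtain ⟨r1, r2⟩ := row_props hC (pcode_min hmin e) hg
  set m : Fin 7 → ℕ := fun k => msk (rt (g k)) with hm
  have hne : ∀ k l, k ≠ l → m k ≠ m l := by
    intro k l hkl h
    have h1 := orth_msk _ _ (r2 k l hkl)
    have h2 := r1 k
    simp only [hm] at h
    rw [← h] at h1
    simp only [orth, Nat.and_self] at h1
    simp only [cands, List.mem_filter, Bool.and_eq_true] at h2
    have h3 := Nat.eq_of_beq_eq_true h1
    have h4 := Nat.eq_of_beq_eq_true h2.2.1
    omega
  have hinj : Function.Injective m := fun k l h => by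
    by_contra hkl
    exact hne k l hkl h
  have hstrict : StrictMono m := hmono.strictMono_of_injective hinj
  have hsub : (List.ofFn m).Sublist cands := by
    refine List.sublist_of_subperm_of_pairwise (r := (· ≤ ·)) (List.subperm_of_subset ?_ ?_) ?_ ?_
    · exact List.nodup_ofFn.2 hinj
    · intro x hx
      rw [List.mem_ofFn] at hx
      obtain ⟨k, rfl⟩ := hx
      exact r1 k
    · rw [List.pairwise_ofFn]
      intro i j hij
      exact hmono hij.le
    · exact (List.pairwise_le_range (n := 128)).filter _
  obtain ⟨t, ht, ht1⟩ := search_sound 60 7 cands [] (List.ofFn m) search_ok hsub (by simp) (by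
    rw [List.pairwise_ofFn]
    intro i j hij
    exact orth_msk _ _ (r2 i j hij.ne))
  have hgood := List.all_eq_true.1 sols_ok t ht
  rw [ht1, List.nil_append] at hgood
  generalize t.2 = p at hgood
  simp only [goodPerm, Bool.and_eq_true, List.all_eq_true, Nat.ble_eq, decide_eq_true_eq,
    Bool.not_eq_true'] at hgood
  obtain ⟨⟨⟨hlen, hlt⟩, hnd⟩, hdot⟩ := hgood
  have hlen := Nat.eq_of_beq_eq_true hlen
  let f : Fin 14 → Fin 14 := fun i => ⟨p[(i : ℕ)]'(by omega),
    Nat.lt_succ_of_le (hlt _ (List.getElem_mem _))⟩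
  have hf : Function.Injective f := by
    intro i j hij
    have : p[(i : ℕ)]'(by omega) = p[(j : ℕ)]'(by omega) := congrArg Fin.val hij
    exact Fin.ext ((hnd.getElem_inj_iff).1 this)
  have hp : p = List.ofFn fun i : Fin 14 => (f i : ℕ) := by
    apply List.ext_getElem
    · simp [hlen]
    · intro i h1 h2
      rw [List.getElem_ofFn]
  let τ : Equiv.Perm (Fin 14) := Equiv.ofBijective f (Finite.injective_iff_bijective.1 hf)
  have hτ : ∀ i, τ i = f i := fun i => rfl
  refine ⟨e.trans τ, fun s hs => ?_⟩
  change (stdv s ∘ τ) ∈ pcode A e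
  refine sys_mem hC hg _ fun k => ?_
  have h1 := hdot s hs _ (mem_gens hg k)
  have h2 := dotp_eq s (msk (g k)) 14 0 (fun i => (f i : ℕ))
  rw [← hp, h1] at h2
  rw [inner2]
  simp only [zero_add, msk_testBit, zmod2_toNat] at h2
  simpa [stdv, hτ] using h2.symm

theorem std_span (C : Submodule (ZMod 2) (Fin 14 → ZMod 2)) (hC : ∀ s ∈ stdWords, stdv s ∈ C)
    (v : Fin 14 → ZMod 2) (hv : ∀ s ∈ stdWords, inner2 v (stdv s) = 0) : v ∈ C := by
  simp only [stdWords, List.forall_mem_cons, List.not_mem_nil, false_imp_iff, implies_true,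
    and_true] at hC hv
  obtain ⟨c1, c2, c3, c4, c5, c6, c7⟩ := hC
  obtain ⟨h1, h2, h3, h4, h5, h6, h7⟩ := hv
  have key : v = (v 1 + v 2) • stdv 85 + (v 0 + v 2) • stdv 102 +
      (v 0 + v 1 + v 2 + v 3) • stdv 120 + (v 0 + v 1 + v 2 + v 7) • stdv 10880 +
      (v 0 + v 1 + v 2 + v 8) • stdv 13056 + (v 0 + v 1 + v 2 + v 10) • stdv 15360 +
      (v 0 + v 1 + v 2) • stdv 16383 := by
    simp only [inner2, stdv, Fin.sum_univ_succ] at h1 h2 h3 h4 h5 h6 h7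
    norm_num [Nat.testBit, Nat.shiftRight_eq_div_pow, Fin.succ] at h1 h2 h3 h4 h5 h6 h7
    have hb : ((1 : ℕ) != 0) = true := rfl
    simp only [hb, Bool.toNat_true, Nat.cast_one, mul_one] at h1 h2 h3 h4 h5 h6 h7
    clear c1 c2 c3 c4 c5 c6 c7 hb
    ext i
    fin_cases i <;> simp [stdv, Nat.testBit, Nat.shiftRight_eq_div_pow] <;> grind
  rw [key]
  exact C.add_mem (C.add_mem (C.add_mem (C.add_mem (C.add_mem (C.add_mem (C.smul_mem _ c1)
    (C.smul_mem _ c2)) (C.smul_mem _ c3)) (C.smul_mem _ c4)) (C.smul_mem _ c5))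
    (C.smul_mem _ c6)) (C.smul_mem _ c7)

theorem pcode_std {A : Submodule (ZMod 2) (Fin 14 → ZMod 2)} (hA : IsSelfDual A)
    (hmin : ∀ a ∈ A, a ≠ 0 → 4 ≤ wt a) :
    ∃ σ : Equiv.Perm (Fin 14), ∀ v, v ∘ σ ∈ A ↔ ∀ s ∈ stdWords, inner2 v (stdv s) = 0 := by
  obtain ⟨σ, hσ⟩ := exists_std hA hmin
  refine ⟨σ, fun v => ⟨fun h s hs => ?_, fun h => std_span (pcode A σ) hσ v h⟩⟩
  exact (mem_iff (pcode_selfDual hA σ) v).1 h _ (hσ s hs)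

/-- Any two self-dual binary codes of length 14 with minimum nonzero weight 4
are permutation equivalent. -/
theorem selfdual_14_min4_unique (A B : Submodule (ZMod 2) (Fin 14 → ZMod 2))
    (hA : IsSelfDual A) (hB : IsSelfDual B)
    (hAmin : ∀ a ∈ A, a ≠ 0 → 4 ≤ wt a) (hAex : ∃ a ∈ A, wt a = 4)
    (hBmin : ∀ b ∈ B, b ≠ 0 → 4 ≤ wt b) (hBex : ∃ b ∈ B, wt b = 4) :
    ∃ π : Equiv.Perm (Fin 14),
      (fun a => a ∘ ⇑π) '' (A : Set (Fin 14 → ZMod 2)) = B := by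
  obtain ⟨σ, hσ⟩ := pcode_std hA hAmin
  obtain ⟨τ, hτ⟩ := pcode_std hB hBmin
  refine ⟨τ.trans σ.symm, ?_⟩
  ext b
  constructor
  · rintro ⟨a, ha, rfl⟩
    have h1 : (a ∘ σ.symm) ∘ σ ∈ A := by
      convert (show a ∈ A from ha) using 1
      ext; simp
    exact (hτ _).2 ((hσ _).1 h1)
  · intro hb
    have h1 : (b ∘ τ.symm) ∘ τ ∈ B := by
      convert (show b ∈ B from hb) using 1
      ext; simp
    refine ⟨(b ∘ τ.symm) ∘ σ, (hσ _).2 ((hτ _).1 h1), ?_⟩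
    ext; simp
end

section
/- Let F16 be the field with 16 elements, F4 = {x ∈ F16 : x^4 = x} its subfield with four elements, and ξ ∈ F16 an element of multiplicative order 5. Define the 5-weight wt5 on F16 by wt5(0) = 0, wt5(x) = 4 if x ≠ 0 and x^5 = 1, and wt5(x) = 2 otherwise, extended to F16^7 by wt5(c) = Σ_{i=1}^{7} wt5(c_i). Let M be the group of F4-semilinear monomial transformations of F16^7 of the form (T v)_i = τ_i(v_{π(i)}) with π ∈ S_7 and each τ_i in the group of maps F16 → F16 generated by x ↦ ξ·x and x ↦ x^4 (a dihedral group of order 10). Then every F4-linear subspace X ⊆ F16^7 of F4-dimension 7 with wt5(x) ≥ 8 for every nonzero x ∈ X is mapped by some T ∈ M to the F4-row span of a systematic matrix Γ ∈ F16^{7×7} of the following form: the entries of Γ in columns 1–3 are Γ_{1,(1,2,3)} = (0,0,0), Γ_{2,(1,2,3)} = (0,0,1), Γ_{3,(1,2,3)} = (0,0,ξ), Γ_{4,(1,2,3)} = (0,1,0), Γ_{5,(1,2,3)} = (0,ξ,0), Γ_{6,(1,2,3)} = (1,0,0), Γ_{7,(1,2,3)} = (ξ,0,0); in column 4, Γ_{1,4}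 = 1 and Γ_{i,4} ∈ {μ·ξ : μ ∈ F4} for i = 2,…,7; and the entries in columns 5–7 are arbitrary elements of F16. -/
/-- The 5-weight on the field `F16` with 16 elements: `wt5 0 = 0`, `wt5 x = 4`
for the nonzero fifth roots of unity, and `wt5 x = 2` otherwise. -/
noncomputable def wt5 (x : GaloisField 2 4) : ℕ :=
  open scoped Classical in
  if x = 0 then 0 else if x ^ 5 = 1 then 4 else 2

open Module

lemma sysB_aux {K W : Type*} [Field K] [AddCommGroup W] [Module K W] [FiniteDimensional K W]
    (hW : finrank K W = 5) (p x y z t: W)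
    (h : Submodule.span K {p, x, y, z, t} = ⊤) (ht : t ∈ Submodule.span K {p, x, y, z}) : False := by
  classical
  have h1 : Submodule.span K {p, x, y, z} = (⊤ : Submodule K W) := by
    rw [eq_top_iff, ← h, Submodule.span_le]
    have hs : ({p, x, y, z} : Set W) ⊆ Submodule.span K {p, x, y, z} := Submodule.subset_span
    rintro u (rfl | rfl | rfl | rfl | rfl)
    · exact hs (by simp)
    · exact hs (by simp)
    · exact hs (by simp)
    · exact hs (by simp)
    · exact ht
  have h2 := finrank_span_finset_le_card (R := K) ({p, x, y, z} : Finset W)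
  have h3 := Finset.card_le_four (a := p) (b := x) (c := y) (d := z)
  have h0 : ((({p, x, y, z} : Finset W) : Set W)) = {p, x, y, z} := by simp
  have h4 : finrank K (Submodule.span K ((({p, x, y, z} : Finset W) : Set W))) = 5 := by
    rw [h0, h1, finrank_top, hW]
  simp only [Set.finrank] at h2
  omega

lemma sysB_mem4 {K W : Type*} [Field K] [AddCommGroup W] [Module K W]
    (p x y z : W) (a b c d : K) : a • p + b • x + c • y + d • z ∈ Submodule.span K {p, x, y, z} := by
  have hs : ({p, x, y, z} : Set W) ⊆ Submodule.span K {p, x, y, z} := Submodule.subset_span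
  refine add_mem (add_mem (add_mem ?_ ?_) ?_) ?_ <;> apply Submodule.smul_mem <;> apply hs <;> simp

/-- Two vectors cannot both extend a frame if their coordinates are proportional. -/
lemma sysB {K W : Type*} [Field K] [AddCommGroup W] [Module K W] [FiniteDimensional K W]
    (hK : Nat.card K = 4)
    (hW : finrank K W = 5) (p : W) (v : Fin 6 → W)
    (h : ∀ i j k l : Fin 6, i ≠ j → i ≠ k → i ≠ l → j ≠ k → j ≠ l → k ≠ l →
      Submodule.span K {p, v i, v j, v k, v l} = ⊤) : False := by
  classical
  have hex : ∀ w : W, ∃ (c : K) (a : Fin 4 → K), w = c • p + a 0 • v 0 + a 1 • v 1 + a 2 • v 2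
      + a 3 • v 3 := by
    intro w
    have hw : w ∈ Submodule.span K {p, v 0, v 1, v 2, v 3} := by
      rw [h 0 1 2 3 (by decide) (by decide) (by decide) (by decide) (by decide) (by decide)]
      trivial
    simp only [Submodule.mem_span_insert, Submodule.mem_span_singleton] at hw
    obtain ⟨c, _, ⟨a0, _, ⟨a1, _, ⟨a2, _, ⟨a3, rfl⟩, rfl⟩, rfl⟩, rfl⟩, rfl⟩ := hw
    refine ⟨c, ![a0, a1, a2, a3], ?_⟩
    simp [add_assoc]
  obtain ⟨c, a, ha⟩ := hex (v 4)
  obtain ⟨d, b, hb⟩ := hex (v 5)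
  have key : ∀ i j k l : Fin 6, ∀ α β γ δ : K, i ≠ j → i ≠ k → i ≠ l → j ≠ k → j ≠ l → k ≠ l →
      v l = α • p + β • v i + γ • v j + δ • v k → False := by
    intro i j k l α β γ δ h1 h2 h3 h4 h5 h6 he
    exact sysB_aux hW _ _ _ _ _ (h i j k l h1 h2 h3 h4 h5 h6) (he ▸ sysB_mem4 _ _ _ _ _ _ _ _)
  have ha0 : ∀ i, a i ≠ 0 := by
    intro i hi
    fin_cases i <;> simp only [Fin.zero_eta, Fin.mk_one, Fin.reduceFinMk] at hi <;>
      rw [hi, zero_smul, add_zero] at ha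
    · exact key 1 2 3 4 c (a 1) (a 2) (a 3) (by decide) (by decide) (by decide) (by decide)
        (by decide) (by decide) ha
    · exact key 0 2 3 4 c (a 0) (a 2) (a 3) (by decide) (by decide) (by decide) (by decide)
        (by decide) (by decide) ha
    · exact key 0 1 3 4 c (a 0) (a 1) (a 3) (by decide) (by decide) (by decide) (by decide)
        (by decide) (by decide) ha
    · exact key 0 1 2 4 c (a 0) (a 1) (a 2) (by decide) (by decide) (by decide) (by decide)
        (by decide) (by decide) ha
  have hb0 : ∀ i, b i ≠ 0 := by
    intro i hi
    fin_cases i <;> simp only [Fin.zero_eta, Fin.mk_one, Fin.reduceFinMk] at hi <;>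
      rw [hi, zero_smul, add_zero] at hb
    · exact key 1 2 3 5 d (b 1) (b 2) (b 3) (by decide) (by decide) (by decide) (by decide)
        (by decide) (by decide) hb
    · exact key 0 2 3 5 d (b 0) (b 2) (b 3) (by decide) (by decide) (by decide) (by decide)
        (by decide) (by decide) hb
    · exact key 0 1 3 5 d (b 0) (b 1) (b 3) (by decide) (by decide) (by decide) (by decide)
        (by decide) (by decide) hb
    · exact key 0 1 2 5 d (b 0) (b 1) (b 2) (by decide) (by decide) (by decide) (by decide)
        (by decide) (by decide) hb
  -- the ratios
  have hdiff : ∀ t : K, v 4 = t • v 5 + (c - t * d) • p + (a 0 - t * b 0) • v 0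
      + (a 1 - t * b 1) • v 1 + (a 2 - t * b 2) • v 2 + (a 3 - t * b 3) • v 3 := by
    intro t
    rw [ha, hb]
    module
  have hinj : ∀ i j : Fin 4, i < j → a i / b i ≠ a j / b j := by
    intro i j hij he
    have e1 : a i - (a i / b i) * b i = 0 := by have := hb0 i; field_simp; ring
    have e2 : a j - (a i / b i) * b j = 0 := by rw [he]; have := hb0 j; field_simp; ring
    have := hdiff (a i / b i)
    generalize a i / b i = t at *
    have fin : ∀ k l : Fin 6, k ≠ l → k ≠ 4 → k ≠ 5 → l ≠ 4 → l ≠ 5 → ∀ γ δ : K,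
        v 4 = t • v 5 + (c - t * d) • p + γ • v k + δ • v l → False := by
      intro k l h1 h2 h3 h4 h5 γ δ he
      refine key 5 k l 4 (c - t * d) t γ δ h3.symm h5.symm (by decide) h1 h2 h4 ?_
      rw [he]; abel
    fin_cases i <;> fin_cases j <;> first
      | exact absurd hij (by decide)
      | (simp only [Fin.zero_eta, Fin.mk_one, Fin.reduceFinMk] at e1 e2
         rw [e1, e2] at this
         simp only [zero_smul, add_zero] at this
         refine fin _ _ ?_ ?_ ?_ ?_ ?_ _ _ this <;> decide)
  have hfin : Finite K := Nat.finite_of_card_ne_zero (by omega)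
  have hI : Function.Injective (fun i : Option (Fin 4) => i.elim (0 : K) (fun i => a i / b i)) := by
    intro i j hij
    rcases i with _ | i <;> rcases j with _ | j
    · rfl
    · exact absurd hij.symm (div_ne_zero (ha0 j) (hb0 j))
    · exact absurd hij (div_ne_zero (ha0 i) (hb0 i))
    · rcases lt_trichotomy i j with h | h | h
      · exact absurd hij (hinj _ _ h)
      · rw [h]
      · exact absurd hij.symm (hinj _ _ h)
  have := Nat.card_le_card_of_injective _ hI
  rw [hK] at this
  simp at this

lemma sysA {K W : Type*} [Field K] [AddCommGroup W] [Module K W] [FiniteDimensional K W]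
    (hK : Nat.card K = 4)
    (hW : finrank K W = 5) (M : Fin 6 → Submodule K W) (h2 : ∀ i, finrank K (M i) ≤ 2)
    (h4 : ∀ i j k l : Fin 6, i ≠ j → i ≠ k → i ≠ l → j ≠ k → j ≠ l → k ≠ l →
      M i ⊔ M j ⊔ M k ⊔ M l = ⊤)
    (h3 : ∀ i j, i ≠ j → finrank K (M i ⊔ M j : Submodule K W) ≤ 3) : False := by
  have hd : ∀ i j k l : Fin 6, i ≠ j → i ≠ k → i ≠ l → j ≠ k → j ≠ l → k ≠ l →
      finrank K (M i ⊔ M j ⊔ M k ⊔ M l : Submodule K W) = 5 := by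
    intro i j k l a b c d e f
    rw [h4 i j k l a b c d e f, finrank_top, hW]
  have hsum : ∀ i j k l : Fin 6, i ≠ j → i ≠ k → i ≠ l → j ≠ k → j ≠ l → k ≠ l →
      5 ≤ finrank K (M i) + finrank K (M j) + finrank K (M k) + finrank K (M l) := by
    intro i j k l a b c d e f
    have := hd i j k l a b c d e f
    have q1 := Submodule.finrank_add_le_finrank_add_finrank (M i) (M j)
    have q2 := Submodule.finrank_add_le_finrank_add_finrank (M i ⊔ M j) (M k)
    have q3 := Submodule.finrank_add_le_finrank_add_finrank (M i ⊔ M j ⊔ M k) (M l)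
    omega
  obtain ⟨a, b, hab, ha, hb⟩ : ∃ a b, a ≠ b ∧ finrank K (M a) = 2 ∧ finrank K (M b) = 2 := by
    have hone : ∀ i j k l : Fin 6, i ≠ j → i ≠ k → i ≠ l → j ≠ k → j ≠ l → k ≠ l →
        finrank K (M i) = 2 ∨ finrank K (M j) = 2 ∨ finrank K (M k) = 2 ∨ finrank K (M l) = 2 := by
      intro i j k l a b c d e f
      have := hsum i j k l a b c d e f
      have := h2 i; have := h2 j; have := h2 k; have := h2 l
      omega
    have hpick : ∀ a : Fin 6, ∃ i j k l : Fin 6, i ≠ j ∧ i ≠ k ∧ i ≠ l ∧ j ≠ k ∧ j ≠ l ∧ k ≠ l ∧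
      a ≠ i ∧ a ≠ j ∧ a ≠ k ∧ a ≠ l := by decide
    have hex : ∀ a : Fin 6, ∃ b, a ≠ b ∧ finrank K (M b) = 2 := by
      intro a
      obtain ⟨i, j, k, l, q1, q2, q3, q4, q5, q6, w1, w2, w3, w4⟩ := hpick a
      rcases hone i j k l q1 q2 q3 q4 q5 q6 with h | h | h | h
      exacts [⟨_, w1, h⟩, ⟨_, w2, h⟩, ⟨_, w3, h⟩, ⟨_, w4, h⟩]
    obtain ⟨a, -, ha⟩ := hex 0
    obtain ⟨b, hab, hb⟩ := hex a
    exact ⟨a, b, hab, ha, hb⟩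
  -- adding one more member raises the dimension by at most one
  have hstep : ∀ (A : Submodule K W) (c : Fin 6), M a ≤ A → c ≠ a →
      finrank K (A ⊔ M c : Submodule K W) ≤ finrank K A + 1 := by
    intro A c hA hc
    have q1 := Submodule.finrank_sup_add_finrank_inf_eq A (M c)
    have q2 := Submodule.finrank_sup_add_finrank_inf_eq (M a) (M c)
    have q3 : finrank K (M a ⊓ M c : Submodule K W) ≤ finrank K (A ⊓ M c : Submodule K W) :=
      Submodule.finrank_mono (inf_le_inf_right _ hA)
    have := h3 a c hc.symm
    have := h2 c
    omega
  have hpick2 : ∀ a b : Fin 6, a ≠ b → ∃ c d, a ≠ c ∧ a ≠ d ∧ b ≠ c ∧ b ≠ d ∧ c ≠ d := by decide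
  have hpick3 : ∀ a b c : Fin 6, ∃ d, a ≠ d ∧ b ≠ d ∧ c ≠ d := by decide
  have hab3 : finrank K (M a ⊔ M b : Submodule K W) = 3 := by
    obtain ⟨c, d, q1, q2, q3, q4, q5⟩ := hpick2 a b hab
    have := hd a b c d hab q1 q2 q3 q4 q5
    have := hstep (M a ⊔ M b) c le_sup_left q1.symm
    have := hstep (M a ⊔ M b ⊔ M c) d (le_sup_left.trans le_sup_left) q2.symm
    have := h3 a b hab
    omega
  have hP : finrank K (M a ⊓ M b : Submodule K W) = 1 := by
    have := Submodule.finrank_sup_add_finrank_inf_eq (M a) (M b)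
    omega
  have hthrough : ∀ c, finrank K (M c) = 2 → M a ⊓ M b ≤ M c := by
    intro c hc
    by_cases hca : c = a
    · rw [hca]; exact inf_le_left
    by_cases hcb : c = b
    · rw [hcb]; exact inf_le_right
    obtain ⟨d, w1, w2, w3⟩ := hpick3 a b c
    have q1 := hd a b c d hab (Ne.symm hca) w1 (Ne.symm hcb) w2 w3
    have q2 := hstep (M a ⊔ M b ⊔ M c) d (le_sup_left.trans le_sup_left) w1.symm
    have q3 := Submodule.finrank_sup_add_finrank_inf_eq (M a ⊔ M b) (M c)
    have q4 := Submodule.finrank_sup_add_finrank_inf_eq (M a) (M c)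
    have q5 := Submodule.finrank_sup_add_finrank_inf_eq (M b) (M c)
    have q6 := h3 a c (Ne.symm hca)
    have q7 := h3 b c (Ne.symm hcb)
    have e1 : M a ⊓ M c = (M a ⊔ M b) ⊓ M c :=
      Submodule.eq_of_le_of_finrank_le (inf_le_inf_right _ le_sup_left) (by omega)
    have e2 : M b ⊓ M c = (M a ⊔ M b) ⊓ M c :=
      Submodule.eq_of_le_of_finrank_le (inf_le_inf_right _ le_sup_right) (by omega)
    have e3 : M a ⊓ M c ≤ M a ⊓ M b := le_inf inf_le_left ((e1.trans e2.symm).le.trans inf_le_left)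
    have e4 : M a ⊓ M c = M a ⊓ M b := Submodule.eq_of_le_of_finrank_le e3 (by omega)
    rw [← e4]; exact inf_le_right
  obtain ⟨p, hp0, hp⟩ := finrank_eq_one_iff'.1 hP
  have hpspan : ∀ w ∈ M a ⊓ M b, w ∈ Submodule.span K {(p : W)} := by
    intro w hw
    obtain ⟨c, hc⟩ := hp ⟨w, hw⟩
    exact Submodule.mem_span_singleton.2 ⟨c, by simpa using congrArg Subtype.val hc⟩
  have hv : ∀ i, ∃ v : W, M i ≤ Submodule.span K {(p : W), v} := by
    intro i
    by_cases hi : finrank K (M i) = 2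
    · have hpi : (p : W) ∈ M i := hthrough i hi p.2
      have : ∃ v ∈ M i, v ∉ Submodule.span K {(p : W)} := by
        by_contra! hcon
        have hle : M i ≤ Submodule.span K {(p : W)} := hcon
        have := Submodule.finrank_mono hle
        have := finrank_span_singleton (K := K) (v := (p : W)) (by simpa using hp0)
        omega
      obtain ⟨v, hvi, hv⟩ := this
      refine ⟨v, ?_⟩
      have hle : Submodule.span K {(p : W), v} ≤ M i := by
        rw [Submodule.span_le]; rintro x (rfl | rfl); exacts [hpi, hvi]
      have hlt : Submodule.span K {(p : W)} < Submodule.span K {(p : W), v} := by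
        refine lt_of_le_of_ne (Submodule.span_mono (by simp)) ?_
        intro he
        exact hv (he ▸ Submodule.subset_span (by simp))
      have := Submodule.finrank_lt_finrank_of_lt hlt
      have := finrank_span_singleton (K := K) (v := (p : W)) (by simpa using hp0)
      exact (Submodule.eq_of_le_of_finrank_le hle (by omega)).ge
    · have h1 : finrank K (M i) ≤ 1 := by have := h2 i; omega
      obtain ⟨v, hv⟩ := finrank_le_one_iff.1 h1
      refine ⟨v, fun w hw => ?_⟩
      obtain ⟨c, hc⟩ := hv ⟨w, hw⟩
      have : w = c • (v : W) := by simpa using (congrArg Subtype.val hc).symm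
      rw [this]
      exact Submodule.smul_mem _ _ (Submodule.subset_span (by simp))
  choose v hv using hv
  refine sysB hK hW (p : W) v ?_
  intro i j k l q1 q2 q3 q4 q5 q6
  rw [eq_top_iff, ← h4 i j k l q1 q2 q3 q4 q5 q6]
  refine sup_le (sup_le (sup_le ?_ ?_) ?_) ?_ <;> refine (hv _).trans (Submodule.span_mono ?_) <;>
    · rintro x (rfl | rfl) <;> simp

lemma sysInf {K X E : Type*} [Field K] [AddCommGroup X] [Module K X] [FiniteDimensional K X]
    [AddCommGroup E] [Module K E] [FiniteDimensional K E] (A : Submodule K X) (f : X →ₗ[K] E)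
    : finrank K A ≤ finrank K (A ⊓ LinearMap.ker f : Submodule K X)
      + finrank K (LinearMap.range f) := by
  have h1 := Submodule.finrank_sup_add_finrank_inf_eq A (LinearMap.ker f)
  have h2 := f.finrank_range_add_finrank_ker
  have h3 := Submodule.finrank_le (A ⊔ LinearMap.ker f)
  omega

lemma sysC {K X E : Type*} [Field K] [AddCommGroup X] [Module K X] [FiniteDimensional K X]
    [AddCommGroup E] [Module K E] [FiniteDimensional K E]
    (hK : Nat.card K = 4) (hE : finrank K E = 2) (hX : finrank K X = 7)
    (f : Fin 7 → X →ₗ[K] E)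
    (hinj : ∀ (i : Fin 7) (a b c d : Fin 6), a ≠ b → a ≠ c → a ≠ d → b ≠ c → b ≠ d → c ≠ d →
      ∀ x, f i x = 0 → f (i.succAbove a) x = 0 → f (i.succAbove b) x = 0 →
        f (i.succAbove c) x = 0 → f (i.succAbove d) x = 0 → x = 0) :
    ∃ i j k : Fin 7, i ≠ j ∧ i ≠ k ∧ j ≠ k ∧
      ∀ u v w : E, ∃ x, f i x = u ∧ f j x = v ∧ f k x = w := by
  have hr2 : ∀ i, finrank K (LinearMap.range (f i)) ≤ 2 := fun i => hE ▸ Submodule.finrank_le _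
  obtain ⟨i, hi⟩ : ∃ i, Function.Surjective (f i) := by
    by_contra! hcon
    have hr : ∀ i, finrank K (LinearMap.range (f i)) ≤ 1 := by
      intro i
      by_contra hlt
      apply hcon i
      rw [← LinearMap.range_eq_top]
      apply Submodule.eq_top_of_finrank_eq
      have := hr2 i
      omega
    have s0 := sysInf (⊤ : Submodule K X) (f 0)
    have s1 := sysInf (⊤ ⊓ LinearMap.ker (f 0)) (f ((0 : Fin 7).succAbove 0))
    have s2 := sysInf (⊤ ⊓ LinearMap.ker (f 0) ⊓ LinearMap.ker (f ((0 : Fin 7).succAbove 0)))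
      (f ((0 : Fin 7).succAbove 1))
    have s3 := sysInf (⊤ ⊓ LinearMap.ker (f 0) ⊓ LinearMap.ker (f ((0 : Fin 7).succAbove 0)) ⊓
      LinearMap.ker (f ((0 : Fin 7).succAbove 1)))
      (f ((0 : Fin 7).succAbove 2))
    have s4 := sysInf (⊤ ⊓ LinearMap.ker (f 0) ⊓ LinearMap.ker (f ((0 : Fin 7).succAbove 0)) ⊓
      LinearMap.ker (f ((0 : Fin 7).succAbove 1)) ⊓ LinearMap.ker (f ((0 : Fin 7).succAbove 2)))
      (f ((0 : Fin 7).succAbove 3))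
    have hbot : (⊤ ⊓ LinearMap.ker (f 0) ⊓ LinearMap.ker (f ((0 : Fin 7).succAbove 0)) ⊓
      LinearMap.ker (f ((0 : Fin 7).succAbove 1)) ⊓ LinearMap.ker (f ((0 : Fin 7).succAbove 2)) ⊓
      LinearMap.ker (f ((0 : Fin 7).succAbove 3))) = ⊥ := by
      rw [eq_bot_iff]
      rintro x ⟨⟨⟨⟨⟨-, x0⟩, x1⟩, x2⟩, x3⟩, x4⟩
      exact hinj 0 0 1 2 3 (by decide) (by decide) (by decide) (by decide) (by decide)
        (by decide) x x0 x1 x2 x3 x4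
    rw [hbot, finrank_bot] at s4
    rw [finrank_top] at s0
    have := hr 0
    have := hr ((0 : Fin 7).succAbove 0)
    have := hr ((0 : Fin 7).succAbove 1)
    have := hr ((0 : Fin 7).succAbove 2)
    have := hr ((0 : Fin 7).succAbove 3)
    omega
  by_contra! hcon
  have hX' : finrank K (LinearMap.ker (f i)) = 5 := by
    have h1 := (f i).finrank_range_add_finrank_ker
    rw [LinearMap.range_eq_top.2 hi, finrank_top] at h1
    omega
  let g : Fin 6 → LinearMap.ker (f i) →ₗ[K] E := fun a =>
    (f (i.succAbove a)).comp (LinearMap.ker (f i)).subtype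
  have hann : ∀ A : Submodule K (LinearMap.ker (f i)),
      finrank K A + finrank K A.dualAnnihilator = 5 := by
    intro A
    rw [← hX']
    exact Subspace.finrank_add_finrank_dualAnnihilator_eq A
  refine sysA hK (W := Dual K (LinearMap.ker (f i))) (by rw [Subspace.dual_finrank_eq, hX'])
    (fun a => (LinearMap.ker (g a)).dualAnnihilator) ?_ ?_ ?_
  · intro a
    have h1 := hann (LinearMap.ker (g a))
    have h2 := (g a).finrank_range_add_finrank_ker
    have h3 := Submodule.finrank_le (LinearMap.range (g a))
    show finrank K (LinearMap.ker (g a)).dualAnnihilator ≤ 2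
    omega
  · intro a b c d q1 q2 q3 q4 q5 q6
    simp only [← Subspace.dualAnnihilator_inf_eq]
    rw [← Submodule.dualAnnihilator_bot]
    congr 1
    rw [eq_bot_iff]
    rintro x ⟨⟨⟨x1, x2⟩, x3⟩, x4⟩
    rw [Submodule.mem_bot]
    exact Subtype.ext (hinj i a b c d q1 q2 q3 q4 q5 q6 x x.2 x1 x2 x3 x4)
  · intro a b hab
    show finrank K ((LinearMap.ker (g a)).dualAnnihilator ⊔ (LinearMap.ker (g b)).dualAnnihilator :
      Submodule K _) ≤ 3
    rw [← Subspace.dualAnnihilator_inf_eq, ← LinearMap.ker_prod]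
    have h1 := hann (LinearMap.ker ((g a).prod (g b)))
    have h2 := ((g a).prod (g b)).finrank_range_add_finrank_ker
    have h3 := Submodule.finrank_le (LinearMap.range ((g a).prod (g b)))
    rw [finrank_prod, hE] at h3
    by_contra hlt
    have htop : LinearMap.range ((g a).prod (g b)) = ⊤ := by
      apply Submodule.eq_top_of_finrank_eq
      rw [finrank_prod, hE]
      omega
    rw [LinearMap.range_eq_top] at htop
    obtain ⟨u, v, w, hh⟩ := hcon i (i.succAbove a) (i.succAbove b) (Fin.succAbove_ne i a).symm
      (Fin.succAbove_ne i b).symm (fun h => hab (Fin.succAbove_right_injective h))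
    obtain ⟨x, hx⟩ := hi u
    obtain ⟨y, hy⟩ := htop (v - f (i.succAbove a) x, w - f (i.succAbove b) x)
    have hy1 : f (i.succAbove a) y = v - f (i.succAbove a) x := congrArg Prod.fst hy
    have hy2 : f (i.succAbove b) y = w - f (i.succAbove b) x := congrArg Prod.snd hy
    have hy0 : f i y = 0 := y.2
    refine hh (x + y) ?_ ?_ ?_
    · rw [map_add, hx, hy0, add_zero]
    · rw [map_add, hy1]; abel
    · rw [map_add, hy2]; abel

lemma sys_card16 : Nat.card (GaloisField 2 4) = 16 := by
  rw [GaloisField.card 2 4 (by norm_num)]; norm_num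

lemma sys_pow15 (x : GaloisField 2 4) (hx : x ≠ 0) : x ^ 15 = 1 := by
  have := Fintype.ofFinite (GaloisField 2 4)
  have h := FiniteField.pow_card_sub_one_eq_one x hx
  rwa [← Nat.card_eq_fintype_card, sys_card16] at h

/-- The subfield with four elements. -/
noncomputable def sysF4 : Subfield (GaloisField 2 4) where
  carrier := {x | x ^ 4 = x}
  mul_mem' := by
    intro a b ha hb
    simp only [Set.mem_ofPred_eq] at *
    rw [mul_pow, ha, hb]
  one_mem' := by simp
  add_mem' := by
    intro a b ha hb
    simp only [Set.mem_ofPred_eq] at *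
    have := add_pow_char_pow (p := 2) (n := 2) a b
    norm_num at this
    rw [this, ha, hb]
  zero_mem' := by simp
  neg_mem' := by
    intro a ha
    simp only [Set.mem_ofPred_eq] at *
    rw [Even.neg_pow (by decide), ha, CharTwo.neg_eq]
  inv_mem' := by
    intro a ha
    simp only [Set.mem_ofPred_eq] at *
    rw [inv_pow, ha]

lemma sys_memF4 (x : GaloisField 2 4) : x ∈ sysF4 ↔ x ^ 4 = x := Iff.rfl

lemma sys_pow5_mem (x : GaloisField 2 4) : x ^ 5 ∈ sysF4 := by
  rw [sys_memF4]
  by_cases hx : x = 0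
  · simp [hx]
  · have := sys_pow15 x hx
    calc (x ^ 5) ^ 4 = x ^ 15 * x ^ 5 := by ring
      _ = x ^ 5 := by rw [this, one_mul]

open Polynomial in
lemma sys_card_roots (n : ℕ) (hn : 0 < n) (q : (GaloisField 2 4)[X]) (hq : q.natDegree = n)
    (S : Set (GaloisField 2 4)) (hS : ∀ x ∈ S, q.eval x = 0) : S.ncard ≤ n := by
  classical
  have hq0 : q ≠ 0 := by rintro rfl; simp at hq; omega
  have h1 : S ⊆ (q.roots.toFinset : Set (GaloisField 2 4)) := by
    intro x hx
    simp [hq0, hS x hx]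
  calc S.ncard ≤ (q.roots.toFinset : Set (GaloisField 2 4)).ncard :=
        Set.ncard_le_ncard h1 (Finset.finite_toSet _)
    _ = q.roots.toFinset.card := Set.ncard_coe_finset _
    _ ≤ q.roots.card := Multiset.toFinset_card_le _
    _ ≤ n := hq ▸ q.card_roots'

lemma sys_exists_omega : ∃ w : GaloisField 2 4, w ∈ sysF4 ∧ w ≠ 0 ∧ w ≠ 1 := by
  by_contra! hcon
  have h : ∀ x : GaloisField 2 4, x ≠ 0 → x ^ 5 = 1 := fun x hx =>
    hcon _ (sys_pow5_mem x) (pow_ne_zero _ hx)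
  have := sys_card_roots 6 (by norm_num)
    (Polynomial.X ^ 6 - Polynomial.X : Polynomial (GaloisField 2 4)) (by compute_degree!) Set.univ (by
      intro x _
      by_cases hx : x = 0
      · simp [hx]
      · have := h x hx
        simp only [Polynomial.eval_sub, Polynomial.eval_pow, Polynomial.eval_X]
        rw [pow_succ, this, one_mul, sub_self])
  rw [Set.ncard_univ, sys_card16] at this
  omega

lemma sys_cardF4 : Nat.card sysF4 = 4 := by
  have hle : Nat.card sysF4 ≤ 4 := by
    have := sys_card_roots 4 (by norm_num)
      (Polynomial.X ^ 4 - Polynomial.X : Polynomial (GaloisField 2 4)) (by compute_degree!)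
      (sysF4 : Set (GaloisField 2 4)) (by
        intro x hx
        have : x ^ 4 = x := hx
        simp [this])
    exact this
  have hpow := Module.natCard_eq_pow_finrank (K := sysF4) (V := GaloisField 2 4)
  rw [sys_card16] at hpow
  obtain ⟨w, hw, hw0, hw1⟩ := sys_exists_omega
  have hge : 3 ≤ Nat.card sysF4 := by
    have hinj : Function.Injective (![⟨w, hw⟩, 0, 1] : Fin 3 → sysF4) := by
      intro i j hij
      have e1 : (⟨w, hw⟩ : sysF4) ≠ 0 := fun h => hw0 (congrArg Subtype.val h)
      have e2 : (⟨w, hw⟩ : sysF4) ≠ 1 := fun h => hw1 (congrArg Subtype.val h)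
      have e3 : (0 : sysF4) ≠ 1 := zero_ne_one
      fin_cases i <;> fin_cases j <;> simp_all
    have := Nat.card_le_card_of_injective _ hinj
    simpa using this
  have h34 : Nat.card sysF4 = 3 ∨ Nat.card sysF4 = 4 := by omega
  rcases h34 with h | h
  · rw [h] at hpow
    exfalso
    have : Odd (3 ^ finrank sysF4 (GaloisField 2 4)) := Odd.pow (by decide)
    rw [← hpow] at this
    exact absurd this (by decide)
  · exact h

lemma sys_finrankF4 : finrank sysF4 (GaloisField 2 4) = 2 := by
  have hpow := Module.natCard_eq_pow_finrank (K := sysF4) (V := GaloisField 2 4)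
  rw [sys_card16, sys_cardF4] at hpow
  have h16 : 4 ^ 2 = 4 ^ finrank sysF4 (GaloisField 2 4) := by rw [← hpow]; norm_num
  exact (Nat.pow_right_injective (by norm_num : 2 ≤ 4) h16).symm

/-- `1, ξ` spans `F16` over `F4`. -/
lemma sys_decomp (ξ : GaloisField 2 4) (hξ : orderOf ξ = 5) (x : GaloisField 2 4) :
    ∃ α β : GaloisField 2 4, α ∈ sysF4 ∧ β ∈ sysF4 ∧ x = α + β * ξ := by
  have hnot : ξ ∉ sysF4 := by
    intro h
    rw [sys_memF4] at h
    have h5 : ξ ^ 5 = 1 := hξ ▸ pow_orderOf_eq_one ξ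
    have h2 : ξ ^ 2 = 1 := by
      calc ξ ^ 2 = ξ ^ 4 * ξ := by rw [h]; ring
        _ = ξ ^ 5 := by ring
        _ = 1 := h5
    have := orderOf_dvd_of_pow_eq_one h2
    rw [hξ] at this
    omega
  have hli : LinearIndependent sysF4 ![(1 : GaloisField 2 4), ξ] := by
    rw [LinearIndependent.pair_iff]
    intro s t hst
    have hst' : (s : GaloisField 2 4) + t * ξ = 0 := by
      simpa [Subfield.smul_def] using hst
    by_cases ht : t = 0
    · subst ht
      refine ⟨?_, rfl⟩
      apply Subtype.ext
      simpa using hst'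
    · exfalso
      apply hnot
      have ht' : (t : GaloisField 2 4) ≠ 0 := fun h => ht (Subtype.ext h)
      have : ξ = ((-s / t : sysF4) : GaloisField 2 4) := by
        push_cast
        field_simp
        linear_combination hst'
      rw [this]
      exact Subtype.prop _
  have hspan := hli.span_eq_top_of_card_eq_finrank' (by simp [sys_finrankF4])
  have hx : x ∈ Submodule.span sysF4 (Set.range ![(1 : GaloisField 2 4), ξ]) := by
    rw [hspan]; trivial
  simp only [Matrix.range_cons, Matrix.range_empty, Set.union_empty, Set.singleton_union,
    Submodule.mem_span_pair] at hx
  obtain ⟨a, b, rfl⟩ := hx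
  exact ⟨a, b, a.2, b.2, by simp [Subfield.smul_def]⟩

/-- A nonzero codeword cannot have Hamming weight at most two. -/
lemma sys_weight (X : Set (Fin 7 → GaloisField 2 4))
    (hsmul : ∀ μ : GaloisField 2 4, μ ^ 4 = μ → ∀ u ∈ X, μ • u ∈ X)
    (hwt : ∀ x ∈ X, x ≠ 0 → 8 ≤ ∑ i, wt5 (x i)) (x : Fin 7 → GaloisField 2 4) (hx : x ∈ X)
    (S : Finset (Fin 7)) (hS : 5 ≤ S.card) (h0 : ∀ i ∈ S, x i = 0) : x = 0 := by
  classical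
  have hle4 : ∀ y, wt5 y ≤ 4 := by
    intro y; unfold wt5; split_ifs <;> omega
  have hcard : Sᶜ.card ≤ 2 := by
    rw [Finset.card_compl, Fintype.card_fin]; omega
  have key : ∀ y ∈ X, (∀ i ∈ S, y i = 0) → ∀ p, y p ≠ 0 → y p ^ 5 = 1 := by
    intro y hy hy0 p hp
    by_contra hne
    have h1 := hwt y hy (fun h => hp (by rw [h]; rfl))
    have hpS : p ∈ Sᶜ := by
      rw [Finset.mem_compl]; exact fun h => hp (hy0 p h)
    have h2 : ∑ i, wt5 (y i) = ∑ i ∈ Sᶜ, wt5 (y i) := by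
      symm
      apply Finset.sum_subset (Finset.subset_univ _)
      intro i _ hi
      rw [Finset.mem_compl, not_not] at hi
      simp [hy0 i hi, wt5]
    rw [h2, ← Finset.add_sum_erase _ _ hpS] at h1
    have h3 : wt5 (y p) = 2 := by simp [wt5, hp, hne]
    have h4 : ∑ i ∈ Sᶜ.erase p, wt5 (y i) ≤ (Sᶜ.erase p).card • 4 :=
      Finset.sum_le_card_nsmul _ _ _ (fun i _ => hle4 _)
    rw [Finset.card_erase_of_mem hpS, smul_eq_mul] at h4
    omega
  by_contra hne
  obtain ⟨p, hp⟩ := Function.ne_iff.1 hne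
  have hp : x p ≠ 0 := hp
  obtain ⟨w, hw, hw0, hw1⟩ := sys_exists_omega
  have e1 := key x hx h0 p hp
  have e2 := key (w • x) (hsmul w hw x hx) (fun i hi => by simp [h0 i hi]) p
    (by simp [hw0, hp])
  have e3 : w ^ 5 = 1 := by
    rw [Pi.smul_apply, smul_eq_mul, mul_pow, e1, mul_one] at e2
    exact e2
  have e4 : w ^ 4 = w := hw
  have e5 : w ^ 2 = 1 := by rw [← e3, pow_succ w 4, e4]; ring
  apply hw1
  calc w = w ^ 4 := e4.symm
    _ = (w ^ 2) ^ 2 := by ring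
    _ = 1 := by rw [e5]; ring

lemma sys_perm (i j k m : Fin 7) (h1 : i ≠ j) (h2 : i ≠ k) (h3 : i ≠ m) (h4 : j ≠ k) (h5 : j ≠ m)
    (h6 : k ≠ m) : ∃ π : Equiv.Perm (Fin 7), π 0 = i ∧ π 1 = j ∧ π 2 = k ∧ π 3 = m := by
  classical
  have hinj : Function.Injective (![i, j, k, m] : Fin 4 → Fin 7) := by
    intro a b hab
    fin_cases a <;> fin_cases b <;> simp_all
  have hinj2 : Function.Injective (![0, 1, 2, 3] : Fin 4 → Fin 7) := by decide
  let e := (Equiv.ofInjective _ hinj2).symm.trans (Equiv.ofInjective _ hinj)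
  have he : ∀ a : Fin 4, e.extendSubtype ((![0, 1, 2, 3] : Fin 4 → Fin 7) a) =
      (![i, j, k, m] : Fin 4 → Fin 7) a := by
    intro a
    rw [Equiv.extendSubtype_apply_of_mem _ _ ⟨a, rfl⟩]
    have h := Equiv.symm_apply_apply (Equiv.ofInjective _ hinj2) a
    exact congrArg (![i, j, k, m] : Fin 4 → Fin 7) h
  exact ⟨e.extendSubtype, he 0, he 1, he 2, he 3⟩

/-- Every nonzero element becomes `1` after scaling by `F4` and a power of `ξ`. -/
lemma sys_norm (ξ : GaloisField 2 4) (hξ : orderOf ξ = 5) (y : GaloisField 2 4) (hy : y ≠ 0) :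
    ∃ (κ : GaloisField 2 4) (a : ℕ), κ ∈ sysF4 ∧ κ ≠ 0 ∧ ξ ^ a * (κ * y) = 1 := by
  have hprim : IsPrimitiveRoot ξ 5 := hξ ▸ IsPrimitiveRoot.orderOf ξ
  have h6 : (y ^ 6) ^ 5 = 1 := by
    calc (y ^ 6) ^ 5 = (y ^ 15) ^ 2 := by ring
      _ = 1 := by rw [sys_pow15 y hy]; ring
  obtain ⟨s, -, hs⟩ := hprim.eq_pow_of_pow_eq_one h6
  refine ⟨y ^ 5, 4 * s, sys_pow5_mem y, pow_ne_zero _ hy, ?_⟩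
  calc ξ ^ (4 * s) * (y ^ 5 * y) = ξ ^ (4 * s) * y ^ 6 := by ring
    _ = (ξ ^ 5) ^ s := by rw [← hs]; ring
    _ = 1 := by rw [hprim.pow_eq_one, one_pow]

lemma sys_fr1 {K V : Type*} [Field K] [AddCommGroup V] [Module K V] (A : Submodule K V)
    (h : finrank K A = 1) : ∃ z : A, z ≠ 0 ∧ ∀ w : A, ∃ c : K, c • z = w :=
  finrank_eq_one_iff'.1 h

/-- Every `F4`-linear code `X ≤ F16^7` of `F4`-dimension 7 (i.e. with
`4^7 = 16384` elements) whose nonzero words have 5-weight at least 8 is mapped,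
by some `F4`-semilinear monomial transformation `(T v) i = τᵢ (v (π i))` with
`π ∈ S_7` and each `τᵢ` in the dihedral group of order 10 generated by
`x ↦ ξ·x` and `x ↦ x⁴`, onto the `F4`-row span of a systematic generator
matrix `Γ` of the shape described in the paper. -/
theorem systematic_form_for_D10 (ξ : GaloisField 2 4) (hξ : orderOf ξ = 5)
    (X : Set (Fin 7 → GaloisField 2 4))
    (hzero : 0 ∈ X)
    (hadd : ∀ u ∈ X, ∀ v ∈ X, u + v ∈ X)
    (hsmul : ∀ μ : GaloisField 2 4, μ ^ 4 = μ → ∀ u ∈ X, μ • u ∈ X)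
    (hcard : Nat.card X = 16384)
    (hwt : ∀ x ∈ X, x ≠ 0 → 8 ≤ ∑ i, wt5 (x i)) :
    ∃ (π : Equiv.Perm (Fin 7)) (a : Fin 7 → ℕ) (b : Fin 7 → Bool)
      (Γ : Fin 7 → Fin 7 → GaloisField 2 4),
      (Γ 0 0 = 0 ∧ Γ 0 1 = 0 ∧ Γ 0 2 = 0 ∧
       Γ 1 0 = 0 ∧ Γ 1 1 = 0 ∧ Γ 1 2 = 1 ∧
       Γ 2 0 = 0 ∧ Γ 2 1 = 0 ∧ Γ 2 2 = ξ ∧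
       Γ 3 0 = 0 ∧ Γ 3 1 = 1 ∧ Γ 3 2 = 0 ∧
       Γ 4 0 = 0 ∧ Γ 4 1 = ξ ∧ Γ 4 2 = 0 ∧
       Γ 5 0 = 1 ∧ Γ 5 1 = 0 ∧ Γ 5 2 = 0 ∧
       Γ 6 0 = ξ ∧ Γ 6 1 = 0 ∧ Γ 6 2 = 0 ∧
       Γ 0 3 = 1 ∧
       (∀ i : Fin 7, i ≠ 0 → ∃ μ : GaloisField 2 4, μ ^ 4 = μ ∧ Γ i 3 = μ * ξ)) ∧
      (fun v : Fin 7 → GaloisField 2 4 =>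
          fun i => ξ ^ (a i) * (if b i then (v (π i)) ^ 4 else v (π i))) '' X
        = {w : Fin 7 → GaloisField 2 4 | ∃ μ : Fin 7 → GaloisField 2 4,
            (∀ j, (μ j) ^ 4 = μ j) ∧ w = fun i => ∑ j, μ j * Γ j i} := by
  classical
  let V : Submodule sysF4 (Fin 7 → GaloisField 2 4) :=
    { carrier := X
      add_mem' := fun {u v} hu hv => hadd u hu v hv
      zero_mem' := hzero
      smul_mem' := fun c u hu => hsmul c c.2 u hu }
  have hV7 : finrank sysF4 V = 7 := by
    have hpow := Module.natCard_eq_pow_finrank (K := sysF4) (V := V)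
    rw [sys_cardF4] at hpow
    have h7 : Nat.card V = 4 ^ 7 := hcard.trans (by norm_num)
    rw [h7] at hpow
    exact (Nat.pow_right_injective (by norm_num : 2 ≤ 4) hpow).symm
  let f : Fin 7 → V →ₗ[sysF4] GaloisField 2 4 := fun i =>
    (LinearMap.proj i).comp V.subtype
  have hf : ∀ i (x : V), f i x = (x : Fin 7 → GaloisField 2 4) i := fun _ _ => rfl
  obtain ⟨i, j, k, hij, hik, hjk, hsurj⟩ := sysC sys_cardF4 sys_finrankF4 hV7 f (by
    intro i a b c d q1 q2 q3 q4 q5 q6 x x0 x1 x2 x3 x4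
    apply Subtype.ext
    refine sys_weight X hsmul hwt x x.2
      {i, i.succAbove a, i.succAbove b, i.succAbove c, i.succAbove d} ?_ ?_
    · have hs : ∀ a b : Fin 6, a ≠ b → i.succAbove a ≠ i.succAbove b := fun a b h h' =>
        h (Fin.succAbove_right_injective h')
      have hi : ∀ a : Fin 6, i ≠ i.succAbove a := fun a => (Fin.succAbove_ne i a).symm
      rw [Finset.card_insert_of_notMem, Finset.card_insert_of_notMem,
        Finset.card_insert_of_notMem, Finset.card_pair (hs _ _ q6)]
      · simp [q4, q5]
      · simp [q1, q2, q3]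
      · simp [hi]
    · intro l hl
      simp only [Finset.mem_insert, Finset.mem_singleton] at hl
      rcases hl with rfl | rfl | rfl | rfl | rfl
      exacts [x0, x1, x2, x3, x4])
  -- the kernel is one-dimensional
  let g : V →ₗ[sysF4] (GaloisField 2 4 × GaloisField 2 4 × GaloisField 2 4) :=
    (f i).prod ((f j).prod (f k))
  have hgs : Function.Surjective g := by
    rintro ⟨u, v, w⟩
    obtain ⟨x, h1, h2, h3⟩ := hsurj u v w
    exact ⟨x, by simp [g, h1, h2, h3]⟩
  have hker : finrank sysF4 (LinearMap.ker g) = 1 := by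
    have h1 := g.finrank_range_add_finrank_ker
    rw [LinearMap.range_eq_top.2 hgs, finrank_top, finrank_prod, finrank_prod, sys_finrankF4,
      hV7] at h1
    omega
  obtain ⟨z, hz0, hz⟩ := sys_fr1 _ hker
  have hzi : ∀ x ∈ LinearMap.ker g, f i x = 0 ∧ f j x = 0 ∧ f k x = 0 := by
    intro x hx
    have hx : (f i x, f j x, f k x) = 0 := hx
    simpa only [Prod.mk_eq_zero] using hx
  obtain ⟨zi, zj, zk⟩ := hzi z z.2
  obtain ⟨m, hm⟩ : ∃ m, f m z ≠ 0 := by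
    by_contra! hcon
    apply hz0
    apply Subtype.ext
    apply Subtype.ext
    funext m
    exact hcon m
  have him : i ≠ m := by rintro rfl; exact hm zi
  have hjm : j ≠ m := by rintro rfl; exact hm zj
  have hkm : k ≠ m := by rintro rfl; exact hm zk
  obtain ⟨π, p0, p1, p2, p3⟩ := sys_perm i j k m hij hik him hjk hjm hkm
  obtain ⟨κ, s, hκ, hκ0, hs⟩ := sys_norm ξ hξ (f m z) hm
  -- first row
  let y : V := (⟨κ, hκ⟩ : sysF4) • (z : V)
  have hyf : ∀ l, f l y = κ * f l z := fun l => rfl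
  have yi : f i y = 0 := by rw [hyf, zi, mul_zero]
  have yj : f j y = 0 := by rw [hyf, zj, mul_zero]
  have yk : f k y = 0 := by rw [hyf, zk, mul_zero]
  have ym : ξ ^ s * f m y = 1 := by rw [hyf, hs]
  have hrow : ∀ u v w : GaloisField 2 4, ∃ x : V, f i x = u ∧ f j x = v ∧ f k x = w ∧
      ∃ μ : GaloisField 2 4, μ ^ 4 = μ ∧ ξ ^ s * f m x = μ * ξ := by
    intro u v w
    obtain ⟨x, h1, h2, h3⟩ := hsurj u v w
    obtain ⟨α, β, hα, hβ, he⟩ := sys_decomp ξ hξ (ξ ^ s * f m x)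
    have hsm : ∀ l, f l (x - (⟨α, hα⟩ : sysF4) • y) = f l x - α * f l y := fun l => rfl
    refine ⟨x - (⟨α, hα⟩ : sysF4) • y, ?_, ?_, ?_, β, hβ, ?_⟩
    · rw [hsm, yi, h1]; ring
    · rw [hsm, yj, h2]; ring
    · rw [hsm, yk, h3]; ring
    · rw [hsm]; linear_combination he - α * ym
  obtain ⟨r1, a1, b1, c1, d1⟩ := hrow 0 0 1
  obtain ⟨r2, a2, b2, c2, d2⟩ := hrow 0 0 ξ
  obtain ⟨r3, a3, b3, c3, d3⟩ := hrow 0 1 0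
  obtain ⟨r4, a4, b4, c4, d4⟩ := hrow 0 ξ 0
  obtain ⟨r5, a5, b5, c5, d5⟩ := hrow 1 0 0
  obtain ⟨r6, a6, b6, c6, d6⟩ := hrow ξ 0 0
  let R : Fin 7 → V := ![y, r1, r2, r3, r4, r5, r6]
  have hR : ∀ x : V, ∃ μ : Fin 7 → sysF4, x = ∑ l, μ l • R l := by
    intro x
    obtain ⟨α0, β0, hα0, hβ0, e0⟩ := sys_decomp ξ hξ (f i x)
    obtain ⟨α1, β1, hα1, hβ1, e1⟩ := sys_decomp ξ hξ (f j x)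
    obtain ⟨α2, β2, hα2, hβ2, e2⟩ := sys_decomp ξ hξ (f k x)
    let x' : V := x - ((⟨α2, hα2⟩ : sysF4) • r1 + (⟨β2, hβ2⟩ : sysF4) • r2 +
      (⟨α1, hα1⟩ : sysF4) • r3 + (⟨β1, hβ1⟩ : sysF4) • r4 + (⟨α0, hα0⟩ : sysF4) • r5 +
      (⟨β0, hβ0⟩ : sysF4) • r6)
    have hx' : ∀ l, f l x' = f l x - (α2 * f l r1 + β2 * f l r2 + α1 * f l r3 + β1 * f l r4 +
      α0 * f l r5 + β0 * f l r6) := fun l => rfl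
    have hxk : x' ∈ LinearMap.ker g := by
      rw [LinearMap.mem_ker]
      show (f i x', f j x', f k x') = 0
      rw [hx', hx', hx', e0, e1, e2, a1, a2, a3, a4, a5, a6, b1, b2, b3, b4, b5, b6, c1, c2, c3,
        c4, c5, c6]
      simp
    obtain ⟨c, hc⟩ := hz ⟨x', hxk⟩
    have hc : c • (z : V) = x' := congrArg Subtype.val hc
    have hκ1 : (⟨κ, hκ⟩ : sysF4) ≠ 0 := fun h => hκ0 (congrArg Subtype.val h)
    have hcy : (c / ⟨κ, hκ⟩) • y = x' := by
      rw [← hc]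
      show (c / (⟨κ, hκ⟩ : sysF4)) • ((⟨κ, hκ⟩ : sysF4) • (z : V)) = _
      rw [smul_smul, div_mul_cancel₀ _ hκ1]
    refine ⟨![c / ⟨κ, hκ⟩, ⟨α2, hα2⟩, ⟨β2, hβ2⟩, ⟨α1, hα1⟩, ⟨β1, hβ1⟩, ⟨α0, hα0⟩, ⟨β0, hβ0⟩], ?_⟩
    rw [Fin.sum_univ_seven]
    show x = (c / ⟨κ, hκ⟩) • y + (⟨α2, hα2⟩ : sysF4) • r1 + (⟨β2, hβ2⟩ : sysF4) • r2 +
      (⟨α1, hα1⟩ : sysF4) • r3 + (⟨β1, hβ1⟩ : sysF4) • r4 + (⟨α0, hα0⟩ : sysF4) • r5 +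
      (⟨β0, hβ0⟩ : sysF4) • r6
    rw [hcy]
    simp only [x']
    abel
  let a : Fin 7 → ℕ := ![0, 0, 0, s, 0, 0, 0]
  have hval : ∀ (μ : Fin 7 → sysF4) (l : Fin 7),
      ((∑ t, μ t • R t : V) : Fin 7 → GaloisField 2 4) l =
        ∑ t, (μ t : GaloisField 2 4) * f l (R t) := by
    intro μ l
    rw [← hf, map_sum]
    rfl
  have g0 : ∀ x : V, ξ ^ a 0 * f (π 0) x = f i x := fun x => by rw [p0]; simp [a]
  have g1 : ∀ x : V, ξ ^ a 1 * f (π 1) x = f j x := fun x => by rw [p1]; simp [a]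
  have g2 : ∀ x : V, ξ ^ a 2 * f (π 2) x = f k x := fun x => by rw [p2]; simp [a]
  have g3 : ∀ x : V, ξ ^ a 3 * f (π 3) x = ξ ^ s * f m x := fun x => by rw [p3]; simp [a]
  refine ⟨π, a, fun _ => false, fun t l => ξ ^ a l * f (π l) (R t), ?_, ?_⟩
  · simp only [g0, g1, g2, g3]
    refine ⟨yi, yj, yk, a1, b1, c1, a2, b2, c2, a3, b3, c3, a4, b4, c4, a5, b5, c5, a6, b6, c6,
      ym, ?_⟩
    intro t ht
    fin_cases t
    exacts [absurd rfl ht, d1, d2, d3, d4, d5, d6]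
  · ext w
    constructor
    · rintro ⟨x, hx, rfl⟩
      obtain ⟨μ, hμ⟩ := hR ⟨x, hx⟩
      refine ⟨fun t => μ t, fun t => (μ t).2, ?_⟩
      funext l
      have := hval μ (π l)
      rw [← hμ] at this
      simp only [Bool.false_eq_true, if_false]
      rw [show x (π l) = _ from this, Finset.mul_sum]
      exact Finset.sum_congr rfl fun t _ => by ring
    · rintro ⟨μ, hμ, rfl⟩
      refine ⟨((∑ t, (⟨μ t, hμ t⟩ : sysF4) • R t : V) : Fin 7 → GaloisField 2 4),
        (∑ t, (⟨μ t, hμ t⟩ : sysF4) • R t : V).2, ?_⟩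
      funext l
      simp only [Bool.false_eq_true, if_false]
      rw [hval, Finset.mul_sum]
      exact Finset.sum_congr rfl fun t _ => by ring
end

section
/- Let F16 be the field with 16 elements with conjugation x̄ = x^4, F4 = {x ∈ F16 : x^4 = x}, and Tr(z) = z + z^4 the trace from F16 to F4. Equip F16^14 with the Hermitian inner product h(u,v) = Σ_{i=1}^{14} u_i·(v_i)^4 and F16^7 with the trace-Hermitian F4-bilinear form s(x,y) = Σ_{i=1}^{7} Tr(x_i·(y_i)^4). Let σ : F16^14 → F16^14 be the F4-linear map σ(x_1,y_1,x_2,y_2,…,x_7,y_7) = (ȳ_1, x̄_1, ȳ_2, x̄_2, …, ȳ_7, x̄_7). Suppose C1 ⊆ F16^14 is an F16-subspace with C1 = {v : h(v,c) = 0 for all c ∈ C1} (Hermitian self-dual) and σ(C1) = C1, and suppose the F4-subspace X := {(x_1,…,x_7) ∈ F16^7 : (x_1, x̄_1, x_2, x̄_2, …, x_7, x̄_7) ∈ C1} has F4-dimension 7. Then X = X^⊥ with respect to s, i.e., X = {v ∈ F16^7 : s(v,x) = 0 for all x ∈ X}, and C1 equals the F16-span of {(x_1, x̄_1, …, x_7,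 x̄_7) : x ∈ X}. -/
/-- The Hermitian inner product on `F16^14`: `h(u,v) = Σᵢ uᵢ · vᵢ⁴`. -/
noncomputable def herm14 (u v : Fin 14 → GaloisField 2 4) : GaloisField 2 4 :=
  ∑ i, u i * (v i) ^ 4

/-- The trace-Hermitian `F4`-bilinear form on `F16^7`:
`s(x,y) = Σᵢ Tr(xᵢ · yᵢ⁴)` with `Tr z = z + z⁴`. -/
noncomputable def traceHerm7 (x y : Fin 7 → GaloisField 2 4) : GaloisField 2 4 :=
  ∑ i, (x i * (y i) ^ 4 + (x i * (y i) ^ 4) ^ 4)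

/-- The `F4`-linear map
`σ(x₁,y₁,…,x₇,y₇) = (ȳ₁,x̄₁,…,ȳ₇,x̄₇)` on `F16^14`, where `x̄ = x⁴`. -/
noncomputable def sigma14 (v : Fin 14 → GaloisField 2 4) :
    Fin 14 → GaloisField 2 4 :=
  fun i => (v ⟨2 * (i.val / 2) + (1 - i.val % 2), by have := i.isLt; omega⟩) ^ 4

/-- The interleaving `F16^7 → F16^14`, `x ↦ (x₁, x̄₁, x₂, x̄₂, …, x₇, x̄₇)`. -/
noncomputable def interleave (x : Fin 7 → GaloisField 2 4) :
    Fin 14 → GaloisField 2 4 :=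
  fun i =>
    if i.val % 2 = 0 then x ⟨i.val / 2, by have := i.isLt; omega⟩
    else (x ⟨i.val / 2, by have := i.isLt; omega⟩) ^ 4

theorem f16_pow (a : GaloisField 2 4) : a ^ 16 = a := by
  have : Fintype (GaloisField 2 4) := Fintype.ofFinite _
  have h := FiniteField.pow_card a
  rw [← Nat.card_eq_fintype_card, GaloisField.card 2 4 (by norm_num)] at h
  simpa using h

theorem f16_add_pow (a b : GaloisField 2 4) : (a + b) ^ 4 = a ^ 4 + b ^ 4 := by
  have h := add_pow_char_pow (R := GaloisField 2 4) (p := 2) (n := 2) a b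
  simpa using h

theorem f16_add_self (a : GaloisField 2 4) : a + a = 0 := CharTwo.add_self_eq_zero a

theorem exists_omega : ∃ w : GaloisField 2 4, w + w ^ 4 ≠ 0 := by
  obtain ⟨g, hg⟩ := IsCyclic.exists_ofOrder_eq_natCard (α := (GaloisField 2 4)ˣ)
  refine ⟨g, fun h => ?_⟩
  rw [Nat.card_units, GaloisField.card 2 4 (by norm_num)] at hg
  have h1 : (g : GaloisField 2 4) ^ 4 = g := by
    linear_combination h - f16_add_self (g : GaloisField 2 4)
  have h2 : g ^ 3 = 1 := by
    have h3 : g ^ 4 = g := Units.ext (by simpa using h1)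
    rw [pow_succ] at h3
    simpa using h3
  have := orderOf_dvd_of_pow_eq_one h2
  rw [hg] at this
  norm_num at this

theorem sigma14_add (u v : Fin 14 → GaloisField 2 4) :
    sigma14 (u + v) = sigma14 u + sigma14 v := by
  funext i
  simp [sigma14, f16_add_pow]

theorem sigma14_smul (a : GaloisField 2 4) (v : Fin 14 → GaloisField 2 4) :
    sigma14 (a • v) = a ^ 4 • sigma14 v := by
  funext i
  simp [sigma14, mul_pow]

theorem sigma14_sigma14 (v : Fin 14 → GaloisField 2 4) : sigma14 (sigma14 v) = v := by
  funext i
  simp only [sigma14, ← pow_mul]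
  rw [f16_pow]
  congr 1
  apply Fin.ext
  simp only
  omega

theorem eq_interleave_of_fixed (w : Fin 14 → GaloisField 2 4) (hw : sigma14 w = w) :
    ∃ x, interleave x = w := by
  refine ⟨fun j => w ⟨2 * j.val, by omega⟩, ?_⟩
  funext i
  simp only [interleave]
  split_ifs with h
  · congr 1
    apply Fin.ext
    simp only
    omega
  · conv_rhs => rw [← hw]
    simp only [sigma14]
    congr 2
    apply Fin.ext
    simp only
    omega

theorem herm14_interleave (v x : Fin 7 → GaloisField 2 4) :
    herm14 (interleave v) (interleave x) = traceHerm7 v x := by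
  simp only [herm14, traceHerm7, interleave, Fin.sum_univ_succ, mul_pow]
  simp
  ring

theorem herm14_add_right (u v w : Fin 14 → GaloisField 2 4) :
    herm14 u (v + w) = herm14 u v + herm14 u w := by
  simp [herm14, f16_add_pow, mul_add, Finset.sum_add_distrib]

theorem herm14_smul_right (a : GaloisField 2 4) (u v : Fin 14 → GaloisField 2 4) :
    herm14 u (a • v) = a ^ 4 * herm14 u v := by
  simp only [herm14, Finset.mul_sum, Pi.smul_apply, smul_eq_mul, mul_pow]
  exact Finset.sum_congr rfl fun i _ => by ring

/-- Galois descent: a `σ`-invariant code is spanned by its fixed vectors. -/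
theorem code_eq_span (C : Submodule (GaloisField 2 4) (Fin 14 → GaloisField 2 4))
    (hC : ∀ c ∈ C, sigma14 c ∈ C) :
    C = Submodule.span (GaloisField 2 4) (interleave '' {x | interleave x ∈ C}) := by
  apply le_antisymm
  · intro c hc
    obtain ⟨w, hw⟩ := exists_omega
    have key : ∀ a : GaloisField 2 4, a • c + a ^ 4 • sigma14 c ∈
        Submodule.span (GaloisField 2 4) (interleave '' {x | interleave x ∈ C}) := by
      intro a
      have hmem : a • c + a ^ 4 • sigma14 c ∈ C :=
        C.add_mem (C.smul_mem _ hc) (C.smul_mem _ (hC c hc))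
      obtain ⟨x, hx⟩ := eq_interleave_of_fixed (a • c + a ^ 4 • sigma14 c) (by
        rw [sigma14_add, sigma14_smul, sigma14_smul, sigma14_sigma14, ← pow_mul, f16_pow,
          add_comm])
      rw [← hx] at hmem ⊢
      exact Submodule.subset_span ⟨x, hmem, rfl⟩
    have h2 := Submodule.add_mem _ (key w) (Submodule.smul_mem _ (w ^ 4) (key 1))
    have h3 : w • c + w ^ 4 • sigma14 c + w ^ 4 • ((1 : GaloisField 2 4) • c
        + (1 : GaloisField 2 4) ^ 4 • sigma14 c) = (w + w ^ 4) • c := by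
      funext i
      simp only [Pi.add_apply, Pi.smul_apply, smul_eq_mul]
      linear_combination f16_add_self (w ^ 4 * sigma14 c i)
    rw [h3] at h2
    exact (Submodule.smul_mem_iff _ hw).1 h2
  · rw [Submodule.span_le]
    rintro _ ⟨x, hx, rfl⟩
    exact hx

/-- If `C1 ≤ F16^14` is a Hermitian self-dual `F16`-linear code invariant
under `σ`, and the `F4`-subspace
`X = {x ∈ F16^7 : (x₁,x̄₁,…,x₇,x̄₇) ∈ C1}` has `F4`-dimension 7 (i.e. `4^7`
elements), then `X` is self-dual for the trace-Hermitian form and `C1` is the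
`F16`-span of the interleaved vectors coming from `X`. -/
theorem fixed_code_traceHermitian_selfdual
    (C1 : Submodule (GaloisField 2 4) (Fin 14 → GaloisField 2 4))
    (hsd : (C1 : Set (Fin 14 → GaloisField 2 4)) = {v | ∀ c ∈ C1, herm14 v c = 0})
    (hσ : sigma14 '' (C1 : Set (Fin 14 → GaloisField 2 4)) = C1)
    (hdim : Nat.card {x : Fin 7 → GaloisField 2 4 | interleave x ∈ C1} = 16384) :
    {x : Fin 7 → GaloisField 2 4 | interleave x ∈ C1}
      = {v : Fin 7 → GaloisField 2 4 |
          ∀ x ∈ {x : Fin 7 → GaloisField 2 4 | interleave x ∈ C1},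
            traceHerm7 v x = 0} ∧
    (C1 : Set (Fin 14 → GaloisField 2 4))
      = ↑(Submodule.span (GaloisField 2 4)
          (interleave '' {x : Fin 7 → GaloisField 2 4 | interleave x ∈ C1})) := by
  have hspan := code_eq_span C1 fun c hc => by
    have : sigma14 c ∈ sigma14 '' (C1 : Set (Fin 14 → GaloisField 2 4)) := ⟨c, hc, rfl⟩
    rw [hσ] at this
    exact this
  have hmem : ∀ v, v ∈ C1 ↔ ∀ c ∈ C1, herm14 v c = 0 := fun v => by
    have := Set.ext_iff.1 hsd v
    exact this
  refine ⟨?_, congrArg _ hspan⟩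
  ext v
  simp only [Set.mem_setOf_eq]
  constructor
  · intro hv x hx
    rw [← herm14_interleave]
    exact (hmem _).1 hv _ hx
  · intro hv
    rw [hmem]
    intro c hc
    rw [hspan] at hc
    induction hc using Submodule.span_induction with
    | mem y hy =>
      obtain ⟨x, hx, rfl⟩ := hy
      rw [herm14_interleave]
      exact hv x hx
    | zero => simp [herm14]
    | add y z _ _ hy hz => rw [herm14_add_right, hy, hz, add_zero]
    | smul a y _ hy => rw [herm14_smul_right, hy, mul_zero]
end
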